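/- Let u₁, u₂ be two distinct bounded classical solutions of the scalar reaction-diffusion equation uₜ = uₓₓ + g(t,u,uₓ) on the circle. Then z(u₁(t,·) − u₂(t,·)) is finite for every t > 0 and nonincreasing in t: for all 0 < t₁ ≤ t₂ one has z(u₁(t₂,·) − u₂(t₂,·)) ≤ z(u₁(t₁,·) − u₂(t₁,·)). -/

import Mathlib

open Real Set Filter

noncomputable def zeroNum (u : ℝ → ℝ) : ℕ∞ :=
  {x ∈ Set.Ico (0 : ℝ) (2 * Real.pi) | u x = 0}.encard

def Admissible (h : ℝ → ℝ → ℝ → ℝ) : Prop :=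
  ∀ K : Set (ℝ × ℝ), IsCompact K →
    (∃ M : ℝ, ∀ t : ℝ, ∀ q ∈ K, |h t q.1 q.2| ≤ M) ∧
    UniformContinuousOn (fun p : ℝ × ℝ × ℝ => h p.1 p.2.1 p.2.2) (Set.univ ×ˢ K)

section

structure Sol (v vt vx vxx : ℝ → ℝ → ℝ) : Prop where
  cv : ContinuousOn (fun p : ℝ × ℝ => v p.1 p.2) (Set.Ioi 0 ×ˢ Set.univ)
  ct : ContinuousOn (fun p : ℝ × ℝ => vt p.1 p.2) (Set.Ioi 0 ×ˢ Set.univ)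
  cx : ContinuousOn (fun p : ℝ × ℝ => vx p.1 p.2) (Set.Ioi 0 ×ˢ Set.univ)
  cxx : ContinuousOn (fun p : ℝ × ℝ => vxx p.1 p.2) (Set.Ioi 0 ×ˢ Set.univ)
  per : ∀ t > (0:ℝ), ∀ x : ℝ, v t (x + 2 * Real.pi) = v t x
  dt : ∀ t > (0:ℝ), ∀ x : ℝ, HasDerivAt (fun s => v s x) (vt t x) t
  dx : ∀ t > (0:ℝ), ∀ x : ℝ, HasDerivAt (fun y => v t y) (vx t x) x
  dxx : ∀ t > (0:ℝ), ∀ x : ℝ, HasDerivAt (fun y => vx t y) (vxx t x) x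
  ineq : ∀ η > (0:ℝ), ∃ C : ℝ, ∀ t ≥ η, ∀ x : ℝ,
    |vt t x - vxx t x| ≤ C * (|v t x| + |vx t x|)
  nz : ∀ t > (0:ℝ), ∃ x : ℝ, v t x ≠ 0

variable {v vt vx vxx : ℝ → ℝ → ℝ}

theorem Sol.neg (S : Sol v vt vx vxx) :
    Sol (fun t x => - v t x) (fun t x => - vt t x) (fun t x => - vx t x) (fun t x => - vxx t x) where
  cv := S.cv.neg
  ct := S.ct.neg
  cx := S.cx.neg
  cxx := S.cxx.neg
  per := fun t ht x => by simp only [S.per t ht x]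
  dt := fun t ht x => (S.dt t ht x).fun_neg
  dx := fun t ht x => (S.dx t ht x).fun_neg
  dxx := fun t ht x => (S.dxx t ht x).fun_neg
  ineq := fun η hη => by
    obtain ⟨C, hC⟩ := S.ineq η hη
    refine ⟨C, fun t ht x => ?_⟩
    have := hC t ht x
    rw [abs_neg, abs_neg, neg_sub_neg, abs_sub_comm]
    exact this
  nz := fun t ht => by
    obtain ⟨x, hx⟩ := S.nz t ht
    exact ⟨x, by simpa using hx⟩

theorem cont_reflect {w : ℝ → ℝ → ℝ}
    (h : ContinuousOn (fun p : ℝ × ℝ => w p.1 p.2) (Set.Ioi 0 ×ˢ Set.univ)) :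
    ContinuousOn (fun p : ℝ × ℝ => w p.1 (-p.2)) (Set.Ioi 0 ×ˢ Set.univ) := by
  have : ContinuousOn (fun p : ℝ × ℝ => ((p.1, -p.2) : ℝ × ℝ)) (Set.Ioi 0 ×ˢ Set.univ) := by
    fun_prop
  exact h.comp this (fun p hp => by simpa using hp)

theorem Sol.reflect (S : Sol v vt vx vxx) :
    Sol (fun t x => v t (-x)) (fun t x => vt t (-x)) (fun t x => - vx t (-x))
      (fun t x => vxx t (-x)) where
  cv := cont_reflect S.cv
  ct := cont_reflect S.ct
  cx := (cont_reflect S.cx).neg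
  cxx := cont_reflect S.cxx
  per := fun t ht x => by
    have := S.per t ht (-(x + 2 * π))
    rw [← this]; congr 1; ring
  dt := fun t ht x => S.dt t ht (-x)
  dx := fun t ht x => by
    have := HasDerivAt.comp x (h₂ := fun y => v t y) (h := fun y => -y) (S.dx t ht (-x)) (hasDerivAt_neg x)
    rw [mul_neg_one] at this
    exact this
  dxx := fun t ht x => by
    have := (HasDerivAt.comp x (h₂ := fun y => vx t y) (h := fun y => -y) (S.dxx t ht (-x)) (hasDerivAt_neg x)).neg
    rw [mul_neg_one, neg_neg] at this
    exact this
  ineq := fun η hη => by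
    obtain ⟨C, hC⟩ := S.ineq η hη
    refine ⟨C, fun t ht x => ?_⟩
    have := hC t ht (-x)
    rwa [abs_neg]
  nz := fun t ht => by
    obtain ⟨x, hx⟩ := S.nz t ht
    exact ⟨-x, by simpa using hx⟩

theorem Sol.per_int (S : Sol v vt vx vxx) {t : ℝ} (ht : 0 < t) (x : ℝ) (k : ℤ) :
    v t (x + k * (2 * π)) = v t x := by
  have : Function.Periodic (v t) (2 * π) := fun y => S.per t ht y
  exact this.int_mul k x

/-- necessary second order condition at a local min -/
theorem second_deriv_nonneg {f f' : ℝ → ℝ} {f'' x : ℝ} (h1 : ∀ y, HasDerivAt f (f' y) y)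
    (h2 : HasDerivAt f' f'' x) (hmin : IsLocalMin f x) : f' x = 0 ∧ 0 ≤ f'' := by
  have h0 : f' x = 0 := hmin.hasDerivAt_eq_zero (h1 x)
  refine ⟨h0, ?_⟩
  by_contra hneg
  push Not at hneg
  have hf' : deriv f = f' := funext fun y => (h1 y).deriv
  have hmax : IsLocalMax f x := by
    apply isLocalMax_of_deriv_deriv_neg
    · rw [hf', h2.deriv]; exact hneg
    · rw [hf']; exact h0
    · exact (h1 x).continuousAt
  have hconst : f =ᶠ[nhds x] fun _ => f x := by
    filter_upwards [hmin, hmax] with y a b using le_antisymm b a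
  have : f' =ᶠ[nhds x] fun _ => 0 := by
    have := hconst.deriv
    rw [hf'] at this
    simpa using this
  have h3 : HasDerivAt f' 0 x := (hasDerivAt_const x (0:ℝ)).congr_of_eventuallyEq this
  have := h2.unique h3
  linarith

theorem deriv_nonpos_of_past {f : ℝ → ℝ} {f' t r : ℝ} (hr : 0 < r) (h : HasDerivAt f f' t)
    (hp : ∀ s ∈ Ioo (t - r) t, f t ≤ f s) : f' ≤ 0 := by
  have h1 : Tendsto (slope f t) (nhdsWithin t (Iio t)) (nhds f') :=
    (hasDerivAt_iff_tendsto_slope_left_right.1 h).1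
  refine le_of_tendsto h1 ?_
  have : Ioo (t - r) t ∈ nhdsWithin t (Iio t) := Ioo_mem_nhdsLT (by linarith)
  filter_upwards [this] with s hs
  rw [slope_def_field]
  apply div_nonpos_of_nonneg_of_nonpos
  · linarith [hp s hs]
  · linarith [hs.2]

/-- past local minimum of `z e^{lam t}` -/
theorem past_min {z zx : ℝ → ℝ → ℝ} {zt zxx t x r lam : ℝ} (hr : 0 < r)
    (dt : HasDerivAt (fun s => z s x) zt t)
    (dx : ∀ y, HasDerivAt (fun y => z t y) (zx t y) y)
    (dxx : HasDerivAt (fun y => zx t y) zxx x)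
    (hmin : ∀ s ∈ Ioc (t - r) t, ∀ y ∈ Ioo (x - r) (x + r),
      z t x * exp (lam * t) ≤ z s y * exp (lam * s)) :
    zx t x = 0 ∧ 0 ≤ zxx ∧ zt + lam * z t x ≤ 0 := by
  have hlm : IsLocalMin (fun y => z t y) x := by
    have : Ioo (x - r) (x + r) ∈ nhds x := Ioo_mem_nhds (by linarith) (by linarith)
    filter_upwards [this] with y hy
    have := hmin t ⟨by linarith, le_rfl⟩ y hy
    exact le_of_mul_le_mul_right this (exp_pos _)
  obtain ⟨a, b⟩ := second_deriv_nonneg dx dxx hlm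
  refine ⟨a, b, ?_⟩
  have hd : HasDerivAt (fun s => z s x * exp (lam * s))
      (zt * exp (lam * t) + z t x * (exp (lam * t) * lam)) t := by
    have := ((hasDerivAt_id t).const_mul lam).exp
    simp only [id, mul_one] at this
    exact dt.mul this
  have := deriv_nonpos_of_past hr hd (fun s hs => hmin s ⟨hs.1, hs.2.le⟩ x
    ⟨by linarith, by linarith⟩)
  have e : zt * exp (lam * t) + z t x * (exp (lam * t) * lam) = (zt + lam * z t x) * exp (lam * t) := by
    ring
  rw [e] at this
  by_contra hc
  push Not at hc
  have := mul_pos hc (exp_pos (lam * t))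
  linarith

def Pos (v : ℝ → ℝ → ℝ) (s a b : ℝ) : Prop := ∀ x ∈ uIcc a b, 0 < v s x

theorem Pos.symm {s a b : ℝ} (h : Pos v s a b) : Pos v s b a := by
  intro x hx; exact h x (by rwa [uIcc_comm])

theorem Pos.trans {s a b c : ℝ} (h : Pos v s a b) (h' : Pos v s b c) : Pos v s a c := by
  intro x hx
  rcases uIcc_subset_uIcc_union_uIcc (b := b) hx with h1 | h1
  · exact h x h1
  · exact h' x h1

theorem Sol.contPos (S : Sol v vt vx vxx) {t x : ℝ} (ht : 0 < t) :
    ContinuousAt (fun p : ℝ × ℝ => v p.1 p.2) (t, x) := by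
  apply S.cv.continuousAt
  exact prod_mem_nhds (Ioi_mem_nhds ht) univ_mem

/-- comparison between two ordered curves -/
theorem Sol.prop_le (S : Sol v vt vx vxx) {s s' : ℝ} (hs : 0 < s) (hss : s ≤ s') {α β : ℝ → ℝ}
    (hα : Continuous α) (hβ : Continuous β)
    (hαβ : ∀ t, α t ≤ β t)
    (pα : ∀ t ∈ Icc s s', 0 < v t (α t)) (pβ : ∀ t ∈ Icc s s', 0 < v t (β t))
    (p0 : ∀ x ∈ Icc (α s) (β s), 0 < v s x) :
    ∀ x ∈ Icc (α s') (β s'), 0 < v s' x := by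
  obtain ⟨C, hC⟩ := S.ineq s hs
  set K := |C| + 1 with hK
  -- the region
  set Rg : Set (ℝ × ℝ) := {p | p.1 ∈ Icc s s' ∧ α p.1 ≤ p.2 ∧ p.2 ≤ β p.1} with hRg
  have hRc : IsClosed Rg := by
    have h1 : IsClosed {p : ℝ × ℝ | α p.1 ≤ p.2} := isClosed_le (by fun_prop) (by fun_prop)
    have h2 : IsClosed {p : ℝ × ℝ | p.2 ≤ β p.1} := isClosed_le (by fun_prop) (by fun_prop)
    exact (isClosed_Icc.preimage continuous_fst).inter (h1.inter h2)
  obtain ⟨m, hm⟩ := (isCompact_Icc (a := s) (b := s')).bddBelow_image hα.continuousOn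
  obtain ⟨M, hM⟩ := (isCompact_Icc (a := s) (b := s')).bddAbove_image hβ.continuousOn
  have hRk : IsCompact Rg := by
    apply (isCompact_Icc.prod isCompact_Icc : IsCompact (Icc s s' ×ˢ Icc m M)).of_isClosed_subset hRc
    rintro ⟨t, x⟩ ⟨h1, h2, h3⟩
    exact ⟨h1, (hm ⟨t, h1, rfl⟩).trans h2, h3.trans (hM ⟨t, h1, rfl⟩)⟩
  set w : ℝ × ℝ → ℝ := fun p => v p.1 p.2 * exp (K * p.1) with hw
  have hwc : ContinuousOn w (Ioi 0 ×ˢ univ) := S.cv.mul (by fun_prop)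
  have hRsub : Rg ⊆ Ioi 0 ×ˢ univ := fun p hp => ⟨lt_of_lt_of_le hs hp.1.1, trivial⟩
  have hwR : ContinuousOn w Rg := hwc.mono hRsub
  -- parabolic boundary
  set Bd : Set (ℝ × ℝ) := {p ∈ Rg | p.1 = s ∨ p.2 = α p.1 ∨ p.2 = β p.1} with hBd
  have hBk : IsCompact Bd := by
    apply hRk.inter_right
    exact ((isClosed_eq (by fun_prop) (by fun_prop)).union
      ((isClosed_eq (by fun_prop) (by fun_prop)).union (isClosed_eq (by fun_prop) (by fun_prop))))
  have hBne : Bd.Nonempty := ⟨(s, α s), ⟨⟨le_rfl, hss⟩, le_rfl, hαβ s⟩, Or.inl rfl⟩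
  obtain ⟨b0, hb0, hbmin⟩ := hBk.exists_isMinOn hBne (hwR.mono (fun p hp => hp.1))
  have hwpos : 0 < w b0 := by
    apply mul_pos _ (exp_pos _)
    obtain ⟨⟨h1, h2, h3⟩, h4 | h4 | h4⟩ := hb0
    · rw [h4] at h2 h3 ⊢; exact p0 _ ⟨h2, h3⟩
    · rw [h4]; exact pα _ h1
    · rw [h4]; exact pβ _ h1
  set μ := w b0 / 2 with hμ
  have hμ0 : 0 < μ := by positivity
  -- bad set
  set Bad : Set (ℝ × ℝ) := Rg ∩ w ⁻¹' Iic μ with hBad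
  have hBadc : IsCompact Bad :=
    hRk.of_isClosed_subset (hwR.preimage_isClosed_of_isClosed hRc isClosed_Iic) inter_subset_left
  by_cases hne : Bad.Nonempty
  · exfalso
    obtain ⟨⟨t, x⟩, hq, hqmin⟩ := hBadc.exists_isMinOn hne (continuous_fst.continuousOn)
    have hqR := hq.1
    have hqle : w (t, x) ≤ μ := hq.2
    have hnB : (t, x) ∉ Bd := by
      intro hB
      have : w b0 ≤ w (t, x) := hbmin hB
      linarith
    have hts : s < t := by
      rcases lt_or_eq_of_le hqR.1.1 with h | h
      · exact h
      · exact absurd ⟨hqR, Or.inl h.symm⟩ hnB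
    have hxα : α t < x := by
      rcases lt_or_eq_of_le hqR.2.1 with h | h
      · exact h
      · exact absurd ⟨hqR, Or.inr (Or.inl h.symm)⟩ hnB
    have hxβ : x < β t := by
      rcases lt_or_eq_of_le hqR.2.2 with h | h
      · exact h
      · exact absurd ⟨hqR, Or.inr (Or.inr h)⟩ hnB
    have ht0 : 0 < t := hs.trans hts
    -- nearby past points lie in region
    have hev : ∀ᶠ p : ℝ × ℝ in nhds (t, x), s < p.1 ∧ α p.1 < p.2 ∧ p.2 < β p.1 := by
      have o1 : IsOpen {p : ℝ × ℝ | s < p.1} := isOpen_lt (by fun_prop) (by fun_prop)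
      have o2 : IsOpen {p : ℝ × ℝ | α p.1 < p.2} := isOpen_lt (by fun_prop) (by fun_prop)
      have o3 : IsOpen {p : ℝ × ℝ | p.2 < β p.1} := isOpen_lt (by fun_prop) (by fun_prop)
      exact (o1.inter (o2.inter o3)).mem_nhds ⟨hts, hxα, hxβ⟩
    obtain ⟨r, hr, hrb⟩ := Metric.eventually_nhds_iff_ball.1 hev
    have hpast : ∀ s₁ ∈ Ioo (t - r) t, ∀ y ∈ Ioo (x - r) (x + r), μ < w (s₁, y) := by
      intro s₁ h1 y h2
      have hmem : (s₁, y) ∈ Metric.ball (t, x) r := by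
        rw [Metric.mem_ball, Prod.dist_eq, max_lt_iff, Real.dist_eq, Real.dist_eq, abs_lt, abs_lt]
        exact ⟨⟨by linarith [h1.1], by linarith [h1.2]⟩, ⟨by linarith [h2.1], by linarith [h2.2]⟩⟩
      have h3 := hrb _ hmem
      by_contra hc
      push Not at hc
      have : (s₁, y) ∈ Bad := ⟨⟨⟨h3.1.le, h1.2.le.trans hqR.1.2⟩, h3.2.1.le, h3.2.2.le⟩, hc⟩
      have := hqmin this
      have h8 : t ≤ s₁ := this
      linarith [h1.2]
    have hpast2 : ∀ s₁ ∈ Ioc (t - r) t, ∀ y ∈ Ioo (x - r) (x + r), μ ≤ w (s₁, y) := by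
      intro s₁ h1 y h2
      rcases lt_or_eq_of_le h1.2 with h | h
      · exact (hpast s₁ ⟨h1.1, h⟩ y h2).le
      · subst h
        have hc : ContinuousAt (fun s => w (s, y)) s₁ := by
          have : ContinuousAt w (s₁, y) :=
            hwc.continuousAt (prod_mem_nhds (Ioi_mem_nhds ht0) univ_mem)
          exact ContinuousAt.comp (f := fun s => (s, y)) this (by fun_prop)
        have hc2 : Tendsto (fun s => w (s, y)) (nhdsWithin s₁ (Iio s₁)) (nhds (w (s₁, y))) :=
          hc.tendsto.mono_left nhdsWithin_le_nhds
        refine ge_of_tendsto hc2 ?_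
        have : Ioo (s₁ - r) s₁ ∈ nhdsWithin s₁ (Iio s₁) := Ioo_mem_nhdsLT (by linarith)
        filter_upwards [this] with s₂ h2'
        exact (hpast s₂ h2' y h2).le
    have hqeq : w (t, x) = μ := le_antisymm hqle
      (hpast2 t ⟨by linarith, le_rfl⟩ x ⟨by linarith, by linarith⟩)
    obtain ⟨e1, e2, e3⟩ := past_min (lam := K) hr (S.dt t ht0 x) (S.dx t ht0) (S.dxx t ht0 x)
      (fun s₁ h1 y h2 => by
        have := hpast2 s₁ h1 y h2
        rw [← hqeq] at this
        exact this)
    have hvpos : 0 < v t x := by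
      have : 0 < w (t, x) := by rw [hqeq]; exact hμ0
      exact (pos_iff_pos_of_mul_pos this).2 (exp_pos _)
    have h5 := hC t hts.le x
    rw [e1, abs_zero, add_zero, abs_of_pos hvpos] at h5
    have h6 := (abs_le.1 h5).1
    have h7 : C * v t x ≤ |C| * v t x := by gcongr; exact le_abs_self C
    rw [hK] at e3
    nlinarith
  · intro x hx
    have hmem : (s', x) ∈ Rg := ⟨⟨hss, le_rfl⟩, hx.1, hx.2⟩
    by_contra hc
    push Not at hc
    apply hne
    refine ⟨(s', x), hmem, ?_⟩
    have : w (s', x) ≤ 0 := mul_nonpos_of_nonpos_of_nonneg hc (exp_pos _).le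
    exact this.trans hμ0.le

theorem Sol.prop (S : Sol v vt vx vxx) {s s' : ℝ} (hs : 0 < s) (hss : s ≤ s') {α β : ℝ → ℝ}
    (hα : Continuous α) (hβ : Continuous β)
    (pα : ∀ t ∈ Icc s s', 0 < v t (α t)) (pβ : ∀ t ∈ Icc s s', 0 < v t (β t))
    (p0 : Pos v s (α s) (β s)) : Pos v s' (α s') (β s') := by
  have := S.prop_le hs hss (α := fun t => min (α t) (β t)) (β := fun t => max (α t) (β t))
    (hα.min hβ) (hα.max hβ) (fun t => min_le_max)
    (fun t ht => by
      rcases min_choice (α t) (β t) with h | h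
      · simp only [h]; exact pα t ht
      · simp only [h]; exact pβ t ht)
    (fun t ht => by
      rcases max_choice (α t) (β t) with h | h
      · simp only [h]; exact pα t ht
      · simp only [h]; exact pβ t ht)
    p0
  exact this

end

section
variable {v vt vx vxx : ℝ → ℝ → ℝ}

theorem past_min' {z zx : ℝ → ℝ → ℝ} {zt zxx t x r lam : ℝ} (hr : 0 < r)
    (ct : ∀ y, ContinuousAt (fun s => z s y) t)
    (dt : HasDerivAt (fun s => z s x) zt t)
    (dx : ∀ y, HasDerivAt (fun y => z t y) (zx t y) y)
    (dxx : HasDerivAt (fun y => zx t y) zxx x)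
    (hmin : ∀ s ∈ Ioo (t - r) t, ∀ y ∈ Ioo (x - r) (x + r),
      z t x * exp (lam * t) ≤ z s y * exp (lam * s)) :
    zx t x = 0 ∧ 0 ≤ zxx ∧ zt + lam * z t x ≤ 0 := by
  apply past_min hr dt dx dxx
  intro s hs y hy
  rcases lt_or_eq_of_le hs.2 with h | h
  · exact hmin s ⟨hs.1, h⟩ y hy
  · subst h
    have hc : ContinuousAt (fun s => z s y * exp (lam * s)) s := (ct y).mul (by fun_prop)
    have hc2 := hc.tendsto.mono_left (nhdsWithin_le_nhds (s := Iio s))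
    refine ge_of_tendsto hc2 ?_
    have : Ioo (s - r) s ∈ nhdsWithin s (Iio s) := Ioo_mem_nhdsLT (by linarith)
    filter_upwards [this] with s₂ h2'
    exact hmin s₂ h2' y hy

def Reach (v : ℝ → ℝ → ℝ) (t0 p t x : ℝ) : Prop :=
  ∃ γ : ℝ → ℝ, Continuous γ ∧ (∃ k : ℤ, γ t0 = p + k * (2 * π)) ∧ γ t = x ∧
    ∀ s ∈ Icc t t0, 0 < v s (γ s)

theorem Reach.shift (S : Sol v vt vx vxx) {t0 p t x : ℝ} (ht : 0 < t) (h : Reach v t0 p t x)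
    (n : ℤ) : Reach v t0 p t (x + n * (2 * π)) := by
  obtain ⟨γ, hγ, ⟨k, hk⟩, hx, hpos⟩ := h
  refine ⟨fun s => γ s + n * (2 * π), by fun_prop, ⟨k + n, ?_⟩, by simp only [hx], ?_⟩
  · simp only [hk]; push_cast; ring
  · intro s hs
    simp only
    rw [S.per_int (ht.trans_le hs.1)]
    exact hpos s hs

theorem Reach.extend {t0 p t x s y : ℝ} (h : Reach v t0 p t x) (ht : t ≤ t0) (hst : s < t)
    (hb : ∀ τ ∈ Icc s t, ∀ y' ∈ uIcc x y, 0 < v τ y') : Reach v t0 p s y := by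
  obtain ⟨γ, hγ, ⟨k, hk⟩, hx, hpos⟩ := h
  have hd : t - s ≠ 0 := by linarith
  refine ⟨fun τ => if t ≤ τ then γ τ else x + (t - τ) / (t - s) * (y - x), ?_, ⟨k, ?_⟩, ?_, ?_⟩
  · apply Continuous.if_le hγ (by fun_prop) continuous_const continuous_id
    intro τ hτ
    simp only [id] at hτ
    subst hτ
    simp [hx]
  · simp only [ht, if_true]; exact hk
  · simp only [not_le.2 hst, if_false]
    rw [div_self hd]; ring
  · intro τ hτ
    by_cases hc : t ≤ τ
    · simp only [hc, if_true]; exact hpos τ ⟨hc, hτ.2⟩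
    · simp only [hc, if_false]
      push Not at hc
      apply hb τ ⟨hτ.1, hc.le⟩
      have h0 : 0 ≤ (t - τ) / (t - s) := div_nonneg (by linarith) (by linarith)
      have h1 : (t - τ) / (t - s) ≤ 1 := by
        rw [div_le_one (by linarith)]; linarith [hτ.1]
      rw [mem_uIcc]
      rcases le_total x y with h | h
      · left; constructor <;> nlinarith
      · right; constructor <;> nlinarith

theorem exists_shift (y : ℝ) : ∃ n : ℤ, y + n * (2 * π) ∈ Icc 0 (2 * π) := by
  have hp : 0 < 2 * π := by positivity
  refine ⟨-⌊y / (2 * π)⌋, ?_⟩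
  have h1 := Int.floor_le (y / (2 * π))
  have h2 := Int.lt_floor_add_one (y / (2 * π))
  rw [le_div_iff₀ hp] at h1
  rw [div_lt_iff₀ hp] at h2
  push_cast
  constructor <;> nlinarith

theorem Sol.path (S : Sol v vt vx vxx) {t1 t0 p : ℝ} (h1 : 0 < t1) (h10 : t1 ≤ t0)
    (hp : 0 < v t0 p) : ∃ γ : ℝ → ℝ, Continuous γ ∧ γ t0 = p ∧ ∀ s ∈ Icc t1 t0, 0 < v s (γ s) := by
  have ht0 : 0 < t0 := h1.trans_le h10
  suffices h : ∃ x, Reach v t0 p t1 x by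
    obtain ⟨x, γ, hγ, ⟨k, hk⟩, hx, hpos⟩ := h
    refine ⟨fun s => γ s + (-k : ℤ) * (2 * π), by fun_prop, ?_, ?_⟩
    · simp only [hk]; push_cast; ring
    · intro s hs
      simp only
      rw [S.per_int (h1.trans_le hs.1)]
      exact hpos s hs
  obtain ⟨C, hC⟩ := S.ineq t1 h1
  set K := |C| + 1 with hK
  set A0 : Set (ℝ × ℝ) := {q | (q.1 ∈ Icc t1 t0 ∧ q.2 ∈ Icc 0 (2 * π)) ∧ Reach v t0 p q.1 q.2} with hA0
  have hsub : closure A0 ⊆ Icc t1 t0 ×ˢ Icc 0 (2 * π) := by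
    apply closure_minimal _ (isClosed_Icc.prod isClosed_Icc)
    exact fun q hq => hq.1
  have hcomp : IsCompact (closure A0) :=
    (isCompact_Icc.prod isCompact_Icc).of_isClosed_subset isClosed_closure hsub
  set w : ℝ × ℝ → ℝ := fun p => v p.1 p.2 * exp (-K * p.1) with hw
  have hwc : ContinuousOn w (Ioi 0 ×ˢ univ) := S.cv.mul (by fun_prop)
  have hwR : ContinuousOn w (closure A0) :=
    hwc.mono (fun q hq => ⟨h1.trans_le (hsub hq).1.1, trivial⟩)
  have hreach0 : Reach v t0 p t0 p := ⟨fun _ => p, continuous_const, ⟨0, by simp⟩, rfl, by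
    intro s hs
    have : s = t0 := le_antisymm hs.2 hs.1
    rw [this]; exact hp⟩
  obtain ⟨n0, hn0⟩ := exists_shift p
  have hmem0 : (t0, p + n0 * (2 * π)) ∈ A0 := ⟨⟨⟨h10, le_rfl⟩, hn0⟩, hreach0.shift S ht0 n0⟩
  obtain ⟨⟨t, x⟩, hm, hmax⟩ := hcomp.exists_isMaxOn ⟨_, subset_closure hmem0⟩ hwR
  have ht1 : t1 ≤ t := (hsub hm).1.1
  have htpos : 0 < t := h1.trans_le ht1
  have hvpos : 0 < v t x := by
    have h2 : w (t0, p + n0 * (2 * π)) ≤ w (t, x) := hmax (subset_closure hmem0)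
    have h3 : 0 < w (t0, p + n0 * (2 * π)) := by
      simp only [hw]
      rw [S.per_int ht0]; positivity
    exact (pos_iff_pos_of_mul_pos (h3.trans_le h2)).2 (exp_pos _)
  have hev : ∀ᶠ q : ℝ × ℝ in nhds (t, x), 0 < v q.1 q.2 :=
    (S.contPos htpos).eventually_const_lt hvpos
  obtain ⟨r, hr, hrb⟩ := Metric.eventually_nhds_iff_ball.1 hev
  have hball : ∀ s y, s ∈ Ioo (t - r) (t + r) → y ∈ Ioo (x - r) (x + r) → 0 < v s y := by
    intro s y hs hy
    apply hrb (s, y)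
    rw [Metric.mem_ball, Prod.dist_eq, max_lt_iff, Real.dist_eq, Real.dist_eq, abs_lt, abs_lt]
    exact ⟨⟨by linarith [hs.1], by linarith [hs.2]⟩, ⟨by linarith [hy.1], by linarith [hy.2]⟩⟩
  -- past points are reachable
  have hpast : ∀ s ∈ Ioo (t - r) t, ∀ y ∈ Ioo (x - r) (x + r), Reach v t0 p s y := by
    intro s hs y hy
    obtain ⟨⟨tn, xn⟩, hn, hd⟩ := Metric.mem_closure_iff.1 hm (min r (t - s))
      (lt_min hr (by linarith [hs.2]))
    rw [Prod.dist_eq, max_lt_iff, Real.dist_eq, Real.dist_eq, lt_min_iff, lt_min_iff, abs_lt, abs_lt,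
      abs_lt] at hd
    simp only at hd
    obtain ⟨⟨⟨a1, a2⟩, ⟨a3, a4⟩⟩, ⟨a5, a6⟩, -⟩ := hd
    refine hn.2.extend hn.1.1.2 (by simp only; linarith) ?_
    intro τ hτ y' hy'
    simp only at hτ hy'
    apply hball
    · exact ⟨by linarith [hτ.1, hs.1], by linarith [hτ.2]⟩
    · rw [mem_uIcc] at hy'
      rcases hy' with ⟨b1, b2⟩ | ⟨b1, b2⟩
      · exact ⟨by linarith, by linarith [hy.2]⟩
      · exact ⟨by linarith [hy.1], by linarith⟩
  rcases lt_or_eq_of_le ht1 with hlt | heq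
  · exfalso
    obtain ⟨e1, e2, e3⟩ := past_min' (lam := -K) (r := min r (t - t1)) (z := fun t x => - v t x) (zx := fun t x => - vx t x)
      (lt_min hr (by linarith))
      (fun y => (S.neg.dt t htpos y).continuousAt)
      (S.neg.dt t htpos x) (S.neg.dx t htpos) (S.neg.dxx t htpos x)
      (fun s hs y hy => by
        have hs1 : t1 < s := by linarith [hs.1, min_le_right r (t - t1)]
        have hs2 : t - r < s := by linarith [hs.1, min_le_left r (t - t1)]
        have hy1 : y ∈ Ioo (x - r) (x + r) := ⟨by linarith [hy.1, min_le_left r (t - t1)],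
          by linarith [hy.2, min_le_left r (t - t1)]⟩
        have hR := hpast s ⟨hs2, hs.2⟩ y hy1
        obtain ⟨n, hn⟩ := exists_shift y
        have hR2 := hR.shift S (h1.trans hs1) n
        have hA : (s, y + n * (2 * π)) ∈ A0 :=
          ⟨⟨⟨hs1.le, hs.2.le.trans (hsub hm).1.2⟩, hn⟩, hR2⟩
        have : w (s, y + n * (2 * π)) ≤ w (t, x) := hmax (subset_closure hA)
        simp only [hw] at this
        rw [S.per_int (h1.trans hs1)] at this
        linarith)
    have h5 := hC t hlt.le x
    have e1' : vx t x = 0 := by simpa using e1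
    rw [e1', abs_zero, add_zero, abs_of_pos hvpos] at h5
    have h6 := (abs_le.1 h5).2
    have h7 : C * v t x ≤ |C| * v t x := by gcongr; exact le_abs_self C
    rw [hK] at e3
    nlinarith
  · obtain ⟨⟨tn, xn⟩, hn, hd⟩ := Metric.mem_closure_iff.1 hm r hr
    rcases lt_or_eq_of_le hn.1.1.1 with hl | hl
    · simp only at hl
      refine ⟨x, hn.2.extend hn.1.1.2 hl ?_⟩
      rw [Prod.dist_eq, max_lt_iff, Real.dist_eq, Real.dist_eq, abs_lt, abs_lt] at hd
      simp only at hd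
      intro τ hτ y' hy'
      simp only at hτ hy'
      apply hball
      · exact ⟨by linarith [hτ.1], by linarith [hτ.2, hd.1.1]⟩
      · rw [mem_uIcc] at hy'
        rcases hy' with ⟨b1, b2⟩ | ⟨b1, b2⟩
        · exact ⟨by linarith [hd.2.2], by linarith⟩
        · exact ⟨by linarith, by linarith [hd.2.1]⟩
    · simp only at hl
      refine ⟨xn, ?_⟩
      rw [hl]; exact hn.2

end

section
open MeasureTheory

noncomputable def Gk (θ x : ℝ) : ℝ := (√θ)⁻¹ * exp (-x ^ 2 / (4 * θ))

theorem Gk_pos {θ : ℝ} (h : 0 < θ) (x : ℝ) : 0 < Gk θ x := by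
  unfold Gk; have := Real.sqrt_pos.2 h; positivity

theorem Gk_cont (θ : ℝ) : Continuous (Gk θ) := by
  unfold Gk; fun_prop

theorem Gk_dx {θ : ℝ} (h : 0 < θ) (x : ℝ) :
    HasDerivAt (Gk θ) (-(x / (2 * θ)) * Gk θ x) x := by
  have h1 : HasDerivAt (fun x : ℝ => -x ^ 2 / (4 * θ)) (-(x / (2 * θ))) x := by
    have := ((hasDerivAt_pow 2 x).fun_neg).div_const (4 * θ)
    refine this.congr_deriv ?_
    field_simp; norm_num; ring
  have := (h1.exp).const_mul (√θ)⁻¹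
  unfold Gk
  refine this.congr_deriv ?_
  ring

theorem Gk_dθ {θ : ℝ} (h : 0 < θ) (x : ℝ) :
    HasDerivAt (fun θ => Gk θ x) ((x ^ 2 / (4 * θ ^ 2) - 1 / (2 * θ)) * Gk θ x) θ := by
  have h1 : HasDerivAt (fun θ : ℝ => -x ^ 2 / (4 * θ)) (x ^ 2 / (4 * θ ^ 2)) θ := by
    have := (hasDerivAt_const θ (-x ^ 2)).fun_div ((hasDerivAt_id θ).const_mul 4) (by simp; positivity)
    refine this.congr_deriv ?_
    simp; field_simp
  have hs := Real.sqrt_pos.2 h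
  have h2 : HasDerivAt (fun θ : ℝ => (√θ)⁻¹) (-(1 / (2 * θ)) * (√θ)⁻¹) θ := by
    have := (Real.hasDerivAt_sqrt h.ne').fun_inv hs.ne'
    refine this.congr_deriv ?_
    have h3 : θ = √θ ^ 2 := (Real.sq_sqrt h.le).symm
    rw [← h3]; field_simp
  have := h2.mul h1.exp
  unfold Gk
  refine this.congr_deriv ?_
  ring

theorem Gk_bd {θ t : ℝ} (h : 0 < θ) (h1 : θ / 2 ≤ t) (h2 : t ≤ 2 * θ) (x : ℝ) :
    Gk t x ≤ (√(θ / 2))⁻¹ * exp (-x ^ 2 / (8 * θ)) := by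
  unfold Gk
  have ht : 0 < t := by linarith
  have h0 : 0 < √(θ / 2) := Real.sqrt_pos.2 (by linarith)
  have : √(θ / 2) ≤ √t := Real.sqrt_le_sqrt h1
  gcongr ?_ * ?_
  · exact inv_anti₀ h0 this
  · apply exp_le_exp.2
    rw [neg_div, neg_div, neg_le_neg_iff]
    exact div_le_div_of_nonneg_left (sq_nonneg x) (by positivity) (by linarith)

noncomputable def Dom (θ x : ℝ) : ℝ := (1 + x ^ 2) * exp (-x ^ 2 / (8 * θ))

theorem Dom_int {θ : ℝ} (h : 0 < θ) : Integrable (Dom θ) := by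
  have hb : 0 < 1 / (8 * θ) := by positivity
  have h1 := integrable_exp_neg_mul_sq hb
  have h2 := integrable_rpow_mul_exp_neg_mul_sq hb (s := 2) (by norm_num)
  have := h1.add h2
  refine this.congr (Eventually.of_forall fun x => ?_)
  simp only [Pi.add_apply, Dom]
  have e : -x ^ 2 / (8 * θ) = - (1 / (8 * θ)) * x ^ 2 := by ring
  rw [e, show (2:ℝ) = ((2:ℕ):ℝ) by norm_num, Real.rpow_natCast]
  ring

theorem int_of_bd {θ K : ℝ} (h : 0 < θ) {F : ℝ → ℝ} (hF : Continuous F)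
    (hb : ∀ x, |F x| ≤ K * (1 + x ^ 2)) : Integrable (fun x => F x * Gk θ x) := by
  refine Integrable.mono' ((Dom_int h).const_mul (K * (√(θ / 2))⁻¹))
    (hF.mul (Gk_cont θ)).aestronglyMeasurable (Eventually.of_forall fun x => ?_)
  rw [Real.norm_eq_abs, abs_mul, abs_of_pos (Gk_pos h x)]
  have h1 := Gk_bd h (by linarith : θ / 2 ≤ θ) (by linarith) x
  have h2 := hb x
  calc |F x| * Gk θ x ≤ (K * (1 + x ^ 2)) * ((√(θ / 2))⁻¹ * exp (-x ^ 2 / (8 * θ))) := by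
        apply mul_le_mul h2 h1 (Gk_pos h x).le ((abs_nonneg _).trans h2)
    _ = _ := by unfold Dom; ring

/-- integration by parts -/
theorem ibp {θ K K' : ℝ} (h : 0 < θ) {F F' : ℝ → ℝ} (hF : ∀ x, HasDerivAt F (F' x) x)
    (hc : Continuous F') (hb : ∀ x, |F x| ≤ K * (1 + x ^ 2))
    (hb' : ∀ x, |F' x - x / (2 * θ) * F x| ≤ K' * (1 + x ^ 2)) :
    ∫ x, (F' x - x / (2 * θ) * F x) * Gk θ x = 0 := by
  have hFc : Continuous F := continuous_iff_continuousAt.2 fun x => (hF x).continuousAt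
  refine integral_eq_zero_of_hasDerivAt_of_integrable (f := fun x => F x * Gk θ x) ?_ ?_ ?_
  · intro x
    have := (hF x).mul (Gk_dx h x)
    refine this.congr_deriv ?_
    ring
  · exact int_of_bd h (by fun_prop) hb'
  · exact int_of_bd h hFc hb

/-- differentiation under the integral -/
theorem dint {tb a t p q K : ℝ} (hθ : 0 < tb - t + a) (ht : t ∈ Ioo p q) {A At : ℝ → ℝ → ℝ}
    (hA : ∀ s ∈ Ioo p q, Continuous (A s)) (hAt : Continuous (At t))
    (hd : ∀ s ∈ Ioo p q, ∀ x, HasDerivAt (fun s => A s x) (At s x) s)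
    (hb : ∀ s ∈ Ioo p q, ∀ x, |A s x| ≤ K) (hb' : ∀ s ∈ Ioo p q, ∀ x, |At s x| ≤ K) :
    HasDerivAt (fun s => ∫ x, A s x * Gk (tb - s + a) x)
      (∫ x, (At t x - (x ^ 2 / (4 * (tb - t + a) ^ 2) - 1 / (2 * (tb - t + a))) * A t x)
        * Gk (tb - t + a) x) t := by
  set θ := tb - t + a with hθd
  set ε := min (θ / 2) (min (t - p) (q - t)) with hε
  have hε0 : 0 < ε := lt_min (by linarith) (lt_min (by linarith [ht.1]) (by linarith [ht.2]))
  have hball : ∀ s ∈ Metric.ball t ε, s ∈ Ioo p q ∧ θ / 2 ≤ tb - s + a ∧ tb - s + a ≤ 2 * θ := by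
    intro s hs
    rw [Metric.mem_ball, Real.dist_eq, abs_lt] at hs
    have e1 : ε ≤ θ / 2 := min_le_left _ _
    have e2 : ε ≤ t - p := (min_le_right _ _).trans (min_le_left _ _)
    have e3 : ε ≤ q - t := (min_le_right _ _).trans (min_le_right _ _)
    refine ⟨⟨by linarith, by linarith⟩, by linarith, by linarith⟩
  have hK : 0 ≤ K := (abs_nonneg _).trans (hb t ht 0)
  set M := K * (1 + 1 / θ ^ 2 + 1 / θ) with hM
  have key := hasDerivAt_integral_of_dominated_loc_of_deriv_le (μ := volume) (𝕜 := ℝ)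
    (F := fun s x => A s x * Gk (tb - s + a) x)
    (F' := fun s x => (At s x - (x ^ 2 / (4 * (tb - s + a) ^ 2) - 1 / (2 * (tb - s + a))) * A s x)
        * Gk (tb - s + a) x) (x₀ := t) (s := Metric.ball t ε)
    (bound := fun x => M * (√(θ / 2))⁻¹ * Dom θ x) (Metric.ball_mem_nhds t hε0)
    ?_ ?_ ?_ ?_ ?_ ?_
  · exact key.2
  · filter_upwards [Metric.ball_mem_nhds t hε0] with s hs
    exact ((hA s (hball s hs).1).mul (Gk_cont _)).aestronglyMeasurable
  · apply int_of_bd hθ (K := K) (hA t ht)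
    intro x
    nlinarith [hb t ht x, sq_nonneg x]
  · have := hA t ht
    have h2 := Gk_cont (tb - t + a)
    apply Continuous.aestronglyMeasurable
    fun_prop
  · refine Eventually.of_forall fun x s hs => ?_
    obtain ⟨h1, h2, h3⟩ := hball s hs
    have hp : 0 < tb - s + a := by linarith
    rw [Real.norm_eq_abs, abs_mul, abs_of_pos (Gk_pos hp x)]
    have hg := Gk_bd hθ h2 h3 x
    have hc : |At s x - (x ^ 2 / (4 * (tb - s + a) ^ 2) - 1 / (2 * (tb - s + a))) * A s x|
        ≤ M * (1 + x ^ 2) := by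
      have i1 : x ^ 2 / (4 * (tb - s + a) ^ 2) ≤ x ^ 2 * (1 / θ ^ 2) := by
        rw [mul_one_div]
        apply div_le_div_of_nonneg_left (sq_nonneg x) (by positivity)
        nlinarith
      have i2 : 1 / (2 * (tb - s + a)) ≤ 1 / θ := by
        apply one_div_le_one_div_of_le hθ; linarith
      have i3 : 0 ≤ x ^ 2 / (4 * (tb - s + a) ^ 2) := by positivity
      have i4 : 0 ≤ 1 / (2 * (tb - s + a)) := by positivity
      have i5 : |x ^ 2 / (4 * (tb - s + a) ^ 2) - 1 / (2 * (tb - s + a))| ≤ x ^ 2 * (1 / θ ^ 2) + 1 / θ := by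
        rw [abs_le]; constructor <;> linarith
      have j1 : 0 ≤ 1 / θ ^ 2 := by positivity
      have j2 : 0 ≤ 1 / θ := by positivity
      calc _ ≤ |At s x| + |(x ^ 2 / (4 * (tb - s + a) ^ 2) - 1 / (2 * (tb - s + a))) * A s x| := abs_sub _ _
        _ ≤ K + (x ^ 2 * (1 / θ ^ 2) + 1 / θ) * K := by
          rw [abs_mul]
          gcongr
          · exact hb' s h1 x
          · exact hb s h1 x
        _ ≤ M * (1 + x ^ 2) := by
          have k1 : 0 ≤ K * x ^ 2 := by positivity
          have k2 : 0 ≤ K * (1 / θ ^ 2) := by positivity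
          have k3 : 0 ≤ K * x ^ 2 * (1 / θ) := by positivity
          rw [hM]; nlinarith
    calc _ ≤ (M * (1 + x ^ 2)) * ((√(θ / 2))⁻¹ * exp (-x ^ 2 / (8 * θ))) :=
          mul_le_mul hc hg (Gk_pos hp x).le ((abs_nonneg _).trans hc)
      _ = _ := by unfold Dom; ring
  · exact (Dom_int hθ).const_mul _
  · refine Eventually.of_forall fun x s hs => ?_
    obtain ⟨h1, h2, h3⟩ := hball s hs
    have hp : 0 < tb - s + a := by linarith
    have g1 : HasDerivAt (fun s => tb - s + a) (-1) s := by
      have := ((hasDerivAt_id s).const_sub tb).add_const a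
      simpa using this
    have g2 := (Gk_dθ hp x).comp s g1
    have := (hd s h1 x).mul g2
    refine this.congr_deriv ?_
    ring_nf
    simp only [Function.comp]
    ring_nf

end

section
open MeasureTheory

def Gr (n : ℕ) (F : ℝ → ℝ) : Prop := Continuous F ∧ ∃ K, 0 ≤ K ∧ ∀ x, |F x| ≤ K * (1 + |x|) ^ n

theorem Gr.of_bd {F : ℝ → ℝ} {K : ℝ} (h : Continuous F) (hb : ∀ x, |F x| ≤ K) : Gr 0 F :=
  ⟨h, K, (abs_nonneg _).trans (hb 0), by simpa using hb⟩

theorem Gr.mul {n m : ℕ} {F F' : ℝ → ℝ} (h : Gr n F) (h' : Gr m F') :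
    Gr (n + m) (fun x => F x * F' x) := by
  obtain ⟨c, K, hK, hb⟩ := h
  obtain ⟨c', K', hK', hb'⟩ := h'
  refine ⟨c.mul c', K * K', by positivity, fun x => ?_⟩
  rw [abs_mul, pow_add]
  calc _ ≤ (K * (1 + |x|) ^ n) * (K' * (1 + |x|) ^ m) :=
        mul_le_mul (hb x) (hb' x) (abs_nonneg _) (by positivity)
    _ = _ := by ring

theorem Gr.add {n : ℕ} {F F' : ℝ → ℝ} (h : Gr n F) (h' : Gr n F') :
    Gr n (fun x => F x + F' x) := by
  obtain ⟨c, K, hK, hb⟩ := h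
  obtain ⟨c', K', hK', hb'⟩ := h'
  refine ⟨c.add c', K + K', by positivity, fun x => ?_⟩
  rw [add_mul]
  exact (abs_add_le _ _).trans (add_le_add (hb x) (hb' x))

theorem Gr.cmul {n : ℕ} {F : ℝ → ℝ} (h : Gr n F) (k : ℝ) : Gr n (fun x => k * F x) := by
  obtain ⟨c, K, hK, hb⟩ := h
  refine ⟨by fun_prop, |k| * K, by positivity, fun x => ?_⟩
  rw [abs_mul, mul_assoc]
  exact mul_le_mul_of_nonneg_left (hb x) (abs_nonneg _)

theorem Gr.sub {n : ℕ} {F F' : ℝ → ℝ} (h : Gr n F) (h' : Gr n F') :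
    Gr n (fun x => F x - F' x) := by
  have := h.add (h'.cmul (-1))
  simpa [sub_eq_add_neg] using this

theorem Gr.mono {n m : ℕ} {F : ℝ → ℝ} (h : Gr n F) (hnm : n ≤ m) : Gr m F := by
  obtain ⟨c, K, hK, hb⟩ := h
  refine ⟨c, K, hK, fun x => (hb x).trans ?_⟩
  have : 1 ≤ 1 + |x| := by linarith [abs_nonneg x]
  gcongr

theorem Gr_id : Gr 1 (fun x => x) := ⟨continuous_id, 1, by norm_num, fun x => by
  simp only [pow_one]; linarith [abs_nonneg x]⟩

theorem Gr_abs {n : ℕ} {F : ℝ → ℝ} (h : Gr n F) : Gr n (fun x => |F x|) := by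
  obtain ⟨c, K, hK, hb⟩ := h
  exact ⟨c.abs, K, hK, by simpa using hb⟩

theorem Gr.bd2 {n : ℕ} {F : ℝ → ℝ} (h : Gr n F) (hn : n ≤ 2) :
    ∃ K, ∀ x, |F x| ≤ K * (1 + x ^ 2) := by
  obtain ⟨c, K, hK, hb⟩ := h.mono hn
  refine ⟨K * 2, fun x => (hb x).trans ?_⟩
  rw [mul_assoc]
  gcongr
  nlinarith [sq_nonneg (|x| - 1), sq_abs x]

noncomputable def II (θ : ℝ) (F : ℝ → ℝ) : ℝ := ∫ x, F x * Gk θ x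

theorem Gr.int {F : ℝ → ℝ} {n : ℕ} {θ : ℝ} (h : Gr n F) (hn : n ≤ 2) (hθ : 0 < θ) :
    Integrable (fun x => F x * Gk θ x) := by
  obtain ⟨K, hK⟩ := h.bd2 hn
  exact int_of_bd hθ h.1 hK

theorem II_add {F F' : ℝ → ℝ} {θ : ℝ} (hθ : 0 < θ) (h : Gr 2 F) (h' : Gr 2 F') :
    II θ (fun x => F x + F' x) = II θ F + II θ F' := by
  unfold II
  rw [← integral_add (h.int le_rfl hθ) (h'.int le_rfl hθ)]
  congr 1; ext x; ring

theorem II_cmul (F : ℝ → ℝ) (θ k : ℝ) : II θ (fun x => k * F x) = k * II θ F := by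
  unfold II
  rw [← integral_const_mul]
  congr 1; ext x; ring

theorem II_mono {F F' : ℝ → ℝ} {θ : ℝ} (hθ : 0 < θ) (h : Gr 2 F) (h' : Gr 2 F')
    (hle : ∀ x, F x ≤ F' x) : II θ F ≤ II θ F' := by
  unfold II
  apply integral_mono (h.int le_rfl hθ) (h'.int le_rfl hθ)
  intro x
  exact mul_le_mul_of_nonneg_right (hle x) (Gk_pos hθ x).le

theorem II_nonneg {F : ℝ → ℝ} {θ : ℝ} (hθ : 0 < θ) (h : ∀ x, 0 ≤ F x) : 0 ≤ II θ F :=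
  integral_nonneg fun x => mul_nonneg (h x) (Gk_pos hθ x).le

theorem II_pos {F : ℝ → ℝ} {θ : ℝ} (hθ : 0 < θ) (hF : Gr 2 F) (h : ∀ x, 0 ≤ F x)
    (hx : ∃ x, F x ≠ 0) : 0 < II θ F := by
  obtain ⟨x, hx⟩ := hx
  have hc : Continuous (fun x => F x * Gk θ x) := hF.1.mul (Gk_cont θ)
  refine (integral_pos_iff_support_of_nonneg (fun x => mul_nonneg (h x) (Gk_pos hθ x).le)
    (hF.int le_rfl hθ)).2 ?_
  exact hc.isOpen_support.measure_pos volume ⟨x, mul_ne_zero hx (Gk_pos hθ x).ne'⟩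

theorem Gr.xdiv {F : ℝ → ℝ} {n : ℕ} (h1 : Gr n F) (θ : ℝ) :
    Gr (n + 1) (fun x => x / (2 * θ) * F x) := by
  have := (h1.mul (Gr_id.cmul (1 / (2 * θ))))
  have e : (fun x => x / (2 * θ) * F x) = fun x => F x * (1 / (2 * θ) * x) := by
    ext x; ring
  rw [e]; exact this

theorem II_ibp {F F' : ℝ → ℝ} {θ : ℝ} (hθ : 0 < θ) (hF : ∀ x, HasDerivAt F (F' x) x)
    (h1 : Gr 1 F) (h2 : Gr 2 F') : II θ (fun x => F' x - x / (2 * θ) * F x) = 0 := by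
  obtain ⟨K, hK⟩ := h1.bd2 (by norm_num)
  have : Gr 2 (fun x => F' x - x / (2 * θ) * F x) := by
    exact h2.sub (h1.xdiv θ)
  obtain ⟨K', hK'⟩ := this.bd2 le_rfl
  exact ibp hθ hF h2.1 hK hK'

theorem II_cs {F F' : ℝ → ℝ} {θ : ℝ} (hθ : 0 < θ) (h : Gr 1 F) (h' : Gr 1 F') :
    II θ (fun x => F x * F' x) ^ 2 ≤ II θ (fun x => F x * F x) * II θ (fun x => F' x * F' x) := by
  have key : ∀ l : ℝ, 0 ≤ II θ (fun x => F' x * F' x) * (l * l) + (2 * II θ (fun x => F x * F' x)) * l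
      + II θ (fun x => F x * F x) := by
    intro l
    have h0 : 0 ≤ II θ (fun x => (F x + l * F' x) * (F x + l * F' x)) :=
      II_nonneg hθ fun x => mul_self_nonneg _
    have e : (fun x => (F x + l * F' x) * (F x + l * F' x)) = fun x =>
      ((l * l) * (F' x * F' x) + (2 * l) * (F x * F' x)) + F x * F x := by ext x; ring
    rw [e, II_add hθ (((h'.mul h').cmul _).add ((h.mul h').cmul _)) (h.mul h),
      II_add hθ ((h'.mul h').cmul _) ((h.mul h').cmul _), II_cmul, II_cmul] at h0
    linarith
  have := discrim_le_zero key
  unfold discrim at this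
  nlinarith

theorem Gk_mono {θ1 θ θ2 : ℝ} (h : 0 < θ1) (h1 : θ1 ≤ θ) (h2 : θ ≤ θ2) (x : ℝ) :
    Gk θ x ≤ √θ2 / √θ1 * Gk θ2 x ∧ √θ1 / √θ2 * Gk θ1 x ≤ Gk θ x := by
  have hp : 0 < θ := by linarith
  have hp2 : 0 < θ2 := by linarith
  have s1 := Real.sqrt_pos.2 h
  have s := Real.sqrt_pos.2 hp
  have s2 := Real.sqrt_pos.2 hp2
  have m1 := Real.sqrt_le_sqrt h1
  have m2 := Real.sqrt_le_sqrt h2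
  unfold Gk
  constructor
  · have e1 : exp (-x ^ 2 / (4 * θ)) ≤ exp (-x ^ 2 / (4 * θ2)) := by
      apply exp_le_exp.2
      rw [neg_div, neg_div, neg_le_neg_iff]
      exact div_le_div_of_nonneg_left (sq_nonneg x) (by positivity) (by linarith)
    have : √θ2 / √θ1 * ((√θ2)⁻¹ * exp (-x ^ 2 / (4 * θ2))) = (√θ1)⁻¹ * exp (-x ^ 2 / (4 * θ2)) := by
      field_simp
    rw [this]
    exact mul_le_mul (inv_anti₀ s1 m1) e1 (exp_pos _).le (by positivity)
  · have e1 : exp (-x ^ 2 / (4 * θ1)) ≤ exp (-x ^ 2 / (4 * θ)) := by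
      apply exp_le_exp.2
      rw [neg_div, neg_div, neg_le_neg_iff]
      exact div_le_div_of_nonneg_left (sq_nonneg x) (by positivity) (by linarith)
    have : √θ1 / √θ2 * ((√θ1)⁻¹ * exp (-x ^ 2 / (4 * θ1))) = (√θ2)⁻¹ * exp (-x ^ 2 / (4 * θ1)) := by
      field_simp
    rw [this]
    exact mul_le_mul (inv_anti₀ s m2) e1 (exp_pos _).le (by positivity)

theorem II_le {F : ℝ → ℝ} {θ1 θ θ2 : ℝ} (h : 0 < θ1) (h1 : θ1 ≤ θ) (h2 : θ ≤ θ2) (hF : Gr 2 F)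
    (h0 : ∀ x, 0 ≤ F x) :
    II θ F ≤ √θ2 / √θ1 * II θ2 F ∧ √θ1 / √θ2 * II θ1 F ≤ II θ F := by
  have hp : 0 < θ := by linarith
  have hp2 : 0 < θ2 := by linarith
  constructor
  · unfold II
    rw [← integral_const_mul]
    apply integral_mono (hF.int le_rfl hp) ((hF.int le_rfl hp2).const_mul _)
    intro x
    have := mul_le_mul_of_nonneg_left (Gk_mono h h1 h2 x).1 (h0 x)
    simp only; linarith
  · unfold II
    rw [← integral_const_mul]
    apply integral_mono ((hF.int le_rfl h).const_mul _) (hF.int le_rfl hp)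
    intro x
    have := mul_le_mul_of_nonneg_left (Gk_mono h h1 h2 x).2 (h0 x)
    simp only; linarith

end

section
open MeasureTheory

structure Loc (V Vt Vx Vxx : ℝ → ℝ → ℝ) (p q C B : ℝ) : Prop where
  ct : ∀ t ∈ Ioo p q, Continuous (Vt t)
  cxx : ∀ t ∈ Ioo p q, Continuous (Vxx t)
  tx : ∀ t ∈ Ioo p q, ∀ x, ContinuousAt (fun s => Vx s x) t
  txx : ∀ t ∈ Ioo p q, ∀ x, ContinuousAt (fun s => Vxx s x) t
  dt : ∀ t ∈ Ioo p q, ∀ x, HasDerivAt (fun s => V s x) (Vt t x) t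
  dx : ∀ t ∈ Ioo p q, ∀ x, HasDerivAt (V t) (Vx t x) x
  dxx : ∀ t ∈ Ioo p q, ∀ x, HasDerivAt (Vx t) (Vxx t x) x
  b : ∀ t ∈ Ioo p q, ∀ x, |V t x| ≤ B
  bt : ∀ t ∈ Ioo p q, ∀ x, |Vt t x| ≤ B
  bx : ∀ t ∈ Ioo p q, ∀ x, |Vx t x| ≤ B
  bxx : ∀ t ∈ Ioo p q, ∀ x, |Vxx t x| ≤ B
  C0 : 0 ≤ C
  ineq : ∀ t ∈ Ioo p q, ∀ x, |Vt t x - Vxx t x| ≤ C * (|V t x| + |Vx t x|)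
  nz : ∀ t ∈ Ioo p q, ∃ x, V t x ≠ 0

section
variable {V Vt Vx Vxx : ℝ → ℝ → ℝ} {p q C B : ℝ}

theorem Loc.g0 (h : Loc V Vt Vx Vxx p q C B) {t : ℝ} (ht : t ∈ Ioo p q) : Gr 0 (V t) :=
  Gr.of_bd (continuous_iff_continuousAt.2 fun x => (h.dx t ht x).continuousAt) (h.b t ht)
theorem Loc.gx (h : Loc V Vt Vx Vxx p q C B) {t : ℝ} (ht : t ∈ Ioo p q) : Gr 0 (Vx t) :=
  Gr.of_bd (continuous_iff_continuousAt.2 fun x => (h.dxx t ht x).continuousAt) (h.bx t ht)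
theorem Loc.gt (h : Loc V Vt Vx Vxx p q C B) {t : ℝ} (ht : t ∈ Ioo p q) : Gr 0 (Vt t) :=
  Gr.of_bd (h.ct t ht) (h.bt t ht)
theorem Loc.gxx (h : Loc V Vt Vx Vxx p q C B) {t : ℝ} (ht : t ∈ Ioo p q) : Gr 0 (Vxx t) :=
  Gr.of_bd (h.cxx t ht) (h.bxx t ht)
theorem Loc.gf (h : Loc V Vt Vx Vxx p q C B) {t : ℝ} (ht : t ∈ Ioo p q) :
    Gr 0 (fun x => Vt t x - Vxx t x) := (h.gt ht).sub (h.gxx ht)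
theorem Loc.gL (h : Loc V Vt Vx Vxx p q C B) {t : ℝ} (ht : t ∈ Ioo p q) (θ : ℝ) :
    Gr 1 (fun x => Vxx t x - x / (2 * θ) * Vx t x) :=
  ((h.gxx ht).mono (by norm_num)).sub ((h.gx ht).xdiv θ)

theorem Loc.H' (h : Loc V Vt Vx Vxx p q C B) {t : ℝ} (ht : t ∈ Ioo p q) {tb a : ℝ}
    (hθ : 0 < tb - t + a) :
    HasDerivAt (fun s => II (tb - s + a) (fun x => V s x * V s x))
      (-2 * II (tb - t + a) (fun x => Vx t x * Vx t x)
        + 2 * II (tb - t + a) (fun x => V t x * (Vt t x - Vxx t x))) t := by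
  have B0 : 0 ≤ B := (abs_nonneg _).trans (h.b t ht 0)
  have key := dint (K := 2 * B * B) hθ ht (A := fun s x => V s x * V s x)
    (At := fun s x => Vt s x * V s x + V s x * Vt s x) ?_ ?_ ?_ ?_ ?_
  rotate_left
  · intro s hs; exact ((h.g0 hs).mul (h.g0 hs)).1
  · exact (((h.gt ht).mul (h.g0 ht)).add ((h.g0 ht).mul (h.gt ht))).1
  · intro s hs x; exact (h.dt s hs x).mul (h.dt s hs x)
  · intro s hs x
    rw [abs_mul]
    have := h.b s hs x
    have := abs_nonneg (V s x)
    nlinarith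
  · intro s hs x
    have h1 := h.b s hs x
    have h2 := h.bt s hs x
    have := abs_nonneg (V s x)
    have := abs_nonneg (Vt s x)
    refine (abs_add_le _ _).trans ?_
    rw [abs_mul, abs_mul]
    nlinarith
  refine key.congr_deriv ?_
  set θ := tb - t + a
  have g0 := h.g0 ht
  have gx := h.gx ht
  have gxx := h.gxx ht
  have gt := h.gt ht
  have i := II_ibp hθ (F := fun x => 2 * (V t x * Vx t x) + x / (2 * θ) * (V t x * V t x))
    (F' := fun x => 2 * (Vx t x * Vx t x + V t x * Vxx t x)
      + ((1 / (2 * θ)) * (V t x * V t x) + x / (2 * θ) * (2 * (V t x * Vx t x)))) ?_ ?_ ?_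
  rotate_left
  · intro x
    have d1 := h.dx t ht x
    have d2 := h.dxx t ht x
    have := ((d1.mul d2).const_mul 2).add (((hasDerivAt_id x).div_const (2 * θ)).mul (d1.mul d1))
    refine this.congr_deriv ?_
    simp only [id, Pi.mul_apply]
    ring
  · exact (((g0.mul gx).cmul 2).mono (by norm_num)).add ((g0.mul g0).xdiv θ)
  · refine Gr.mono (n := 1) ?_ (by norm_num)
    exact ((((gx.mul gx).add (g0.mul gxx)).cmul 2).mono (by norm_num)).add
      ((((g0.mul g0).cmul _).mono (by norm_num)).add (((g0.mul gx).cmul 2).xdiv θ))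
  rw [← II_cmul, ← II_cmul, ← II_add hθ (((gx.mul gx).cmul _).mono (by norm_num))
    (((g0.mul (h.gf ht)).cmul _).mono (by norm_num))]
  rw [← add_zero (II θ _), ← i, ← II_add hθ]
  · unfold II
    congr 1; ext x
    field_simp
    ring
  · exact (((gx.mul gx).cmul _).add ((g0.mul (h.gf ht)).cmul _)).mono (by norm_num)
  · have := (((((gx.mul gx).add (g0.mul gxx)).cmul 2).mono (m := 2) (by norm_num)).add
      ((((g0.mul g0).cmul (1 / (2 * θ))).mono (by norm_num)).add ((((g0.mul gx).cmul 2).xdiv θ).mono (by norm_num))))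
    refine this.sub ?_
    exact Gr.xdiv ((((g0.mul gx).cmul 2).mono (by norm_num)).add ((g0.mul g0).xdiv θ)) θ

theorem Loc.ibp1 (h : Loc V Vt Vx Vxx p q C B) {t : ℝ} (ht : t ∈ Ioo p q) {θ : ℝ} (hθ : 0 < θ) :
    II θ (fun x => Vx t x * Vx t x) =
      - II θ (fun x => V t x * (Vxx t x - x / (2 * θ) * Vx t x)) := by
  have i := II_ibp hθ (F := fun x => V t x * Vx t x)
    (F' := fun x => Vx t x * Vx t x + V t x * Vxx t x)
    (fun x => (h.dx t ht x).mul (h.dxx t ht x))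
    (((h.g0 ht).mul (h.gx ht)).mono (by norm_num))
    ((((h.gx ht).mul (h.gx ht)).add ((h.g0 ht).mul (h.gxx ht))).mono (by norm_num))
  have := II_add hθ (((h.gx ht).mul (h.gx ht)).mono (by norm_num))
    (((h.g0 ht).mul (h.gL ht θ)).mono (by norm_num))
  rw [eq_neg_iff_add_eq_zero, ← this, ← i]
  congr 1; ext x; ring

theorem Loc.D1 (h : Loc V Vt Vx Vxx p q C B) {t : ℝ} (ht : t ∈ Ioo p q) {s : ℝ} (hs : s ∈ Ioo p q)
    {θ : ℝ} (hθ : 0 < θ) :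
    II θ (fun x => Vx s x * Vx s x - Vx t x * Vx t x) =
      II θ (fun x => -((V s x - V t x) * ((Vxx s x + Vxx t x) - x / (2 * θ) * (Vx s x + Vx t x)))) := by
  have i := II_ibp hθ (F := fun x => (V s x - V t x) * (Vx s x + Vx t x))
    (F' := fun x => (Vx s x - Vx t x) * (Vx s x + Vx t x) + (V s x - V t x) * (Vxx s x + Vxx t x))
    (fun x => ((h.dx s hs x).sub (h.dx t ht x)).mul ((h.dxx s hs x).add (h.dxx t ht x)))
    ((((h.g0 hs).sub (h.g0 ht)).mul ((h.gx hs).add (h.gx ht))).mono (by norm_num))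
    (((((h.gx hs).sub (h.gx ht)).mul ((h.gx hs).add (h.gx ht))).add
      (((h.g0 hs).sub (h.g0 ht)).mul ((h.gxx hs).add (h.gxx ht)))).mono (by norm_num))
  have g1 : Gr 2 (fun x => (V s x - V t x) * ((Vxx s x + Vxx t x) - x / (2 * θ) * (Vx s x + Vx t x))) :=
    (((h.g0 hs).sub (h.g0 ht)).mul ((((h.gxx hs).add (h.gxx ht)).mono (m := 1) (by norm_num)).sub
      (((h.gx hs).add (h.gx ht)).xdiv θ))).mono (by norm_num)
  have g2 : Gr 2 (fun x => Vx s x * Vx s x - Vx t x * Vx t x) :=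
    (((h.gx hs).mul (h.gx hs)).sub ((h.gx ht).mul (h.gx ht))).mono (by norm_num)
  have := II_add hθ g2 g1
  have e := II_cmul (fun x => (V s x - V t x) * ((Vxx s x + Vxx t x) - x / (2 * θ) * (Vx s x + Vx t x))) θ (-1)
  simp only [neg_one_mul] at e
  rw [e, eq_neg_iff_add_eq_zero, ← this, ← i]
  congr 1; ext x; ring

theorem Loc.D1' (h : Loc V Vt Vx Vxx p q C B) {t : ℝ} (ht : t ∈ Ioo p q) {tb a : ℝ}
    (hθ : 0 < tb - t + a) :
    HasDerivAt (fun s => II (tb - s + a) (fun x => Vx s x * Vx s x - Vx t x * Vx t x))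
      (II (tb - t + a) (fun x => -(Vt t x * (2 * (Vxx t x - x / (2 * (tb - t + a)) * Vx t x))))) t := by
  set θ := tb - t + a with hθd
  have B0 : 0 ≤ B := (abs_nonneg _).trans (h.b t ht 0)
  set ε := min (θ / 2) (min (t - p) (q - t)) with hε
  have hε0 : 0 < ε := lt_min (by linarith) (lt_min (by linarith [ht.1]) (by linarith [ht.2]))
  have hball : ∀ s ∈ Metric.ball t ε, s ∈ Ioo p q ∧ θ / 2 ≤ tb - s + a ∧ tb - s + a ≤ 2 * θ := by
    intro s hs
    rw [Metric.mem_ball, Real.dist_eq, abs_lt] at hs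
    have e1 : ε ≤ θ / 2 := min_le_left _ _
    have e2 : ε ≤ t - p := (min_le_right _ _).trans (min_le_left _ _)
    have e3 : ε ≤ q - t := (min_le_right _ _).trans (min_le_right _ _)
    refine ⟨⟨by linarith, by linarith⟩, by linarith, by linarith⟩
  rw [hasDerivAt_iff_tendsto_slope]
  have hev : ∀ᶠ s in nhdsWithin t {t}ᶜ, s ∈ Metric.ball t ε :=
    mem_nhdsWithin_of_mem_nhds (Metric.ball_mem_nhds t hε0)
  have heq : (fun s => II (tb - s + a) (fun x => -(slope (fun s => V s x) t s *
      ((Vxx s x + Vxx t x) - x / (2 * (tb - s + a)) * (Vx s x + Vx t x)))))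
      =ᶠ[nhdsWithin t {t}ᶜ] slope (fun s => II (tb - s + a) (fun x => Vx s x * Vx s x - Vx t x * Vx t x)) t := by
    filter_upwards [hev] with s hs
    obtain ⟨h1, h2, h3⟩ := hball s hs
    have hp : 0 < tb - s + a := by linarith
    rw [slope_def_module]
    have z : II (tb - t + a) (fun x => Vx t x * Vx t x - Vx t x * Vx t x) = 0 := by
      simp [II]
    rw [z, sub_zero, h.D1 ht h1 hp, smul_eq_mul, ← II_cmul]
    congr 1; ext x
    rw [slope_def_module, smul_eq_mul]; ring
  refine Tendsto.congr' heq ?_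
  unfold II
  refine tendsto_integral_filter_of_dominated_convergence
    (fun x => (B * (2 * B + 2 * B / θ)) * 2 * (√(θ / 2))⁻¹ * Dom θ x) ?_ ?_ ((Dom_int hθ).const_mul _) ?_
  · filter_upwards [hev] with s hs
    obtain ⟨h1, h2, h3⟩ := hball s hs
    have c1 := (h.g0 h1).1
    have c2 := (h.g0 ht).1
    have c3 := (h.gx h1).1
    have c4 := (h.gx ht).1
    have c5 := (h.gxx h1).1
    have c6 := (h.gxx ht).1
    have c7 := Gk_cont (tb - s + a)
    simp only [slope_def_module, smul_eq_mul]
    apply Continuous.aestronglyMeasurable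
    fun_prop
  · filter_upwards [hev] with s hs
    refine Eventually.of_forall fun x => ?_
    obtain ⟨h1, h2, h3⟩ := hball s hs
    have hp : 0 < tb - s + a := by linarith
    rw [Real.norm_eq_abs, abs_mul, abs_of_pos (Gk_pos hp x), abs_neg, abs_mul]
    have hg := Gk_bd hθ h2 h3 x
    have hsl : |slope (fun s => V s x) t s| ≤ B := by
      have := Convex.norm_image_sub_le_of_norm_hasDerivWithin_le (𝕜 := ℝ) (f := fun s => V s x)
        (f' := fun s => Vt s x) (s := Ioo p q) (C := B)
        (fun y hy => (h.dt y hy x).hasDerivWithinAt) (fun y hy => h.bt y hy x) (convex_Ioo p q) ht h1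
      rw [slope_def_module, smul_eq_mul, abs_mul, abs_inv]
      rw [Real.norm_eq_abs, Real.norm_eq_abs] at this
      rcases eq_or_ne s t with e | e
      · simpa [e] using B0
      · have : 0 < |s - t| := abs_pos.2 (sub_ne_zero.2 e)
        rw [inv_mul_le_iff₀ this]; linarith
    have hL : |(Vxx s x + Vxx t x) - x / (2 * (tb - s + a)) * (Vx s x + Vx t x)|
        ≤ (2 * B + 2 * B / θ) * 2 * (1 + x ^ 2) := by
      have k1 : |Vxx s x + Vxx t x| ≤ 2 * B :=
        (abs_add_le _ _).trans (by linarith [h.bxx s h1 x, h.bxx t ht x])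
      have k2 : |Vx s x + Vx t x| ≤ 2 * B :=
        (abs_add_le _ _).trans (by linarith [h.bx s h1 x, h.bx t ht x])
      have k3 : |x / (2 * (tb - s + a))| ≤ |x| / θ := by
        rw [abs_div, abs_of_pos (by linarith : 0 < 2 * (tb - s + a))]
        exact div_le_div_of_nonneg_left (abs_nonneg x) hθ (by linarith)
      have k4 : |x| ≤ 1 + x ^ 2 := by nlinarith [sq_nonneg (|x| - 1), sq_abs x]
      refine (abs_sub _ _).trans ?_
      rw [abs_mul]
      calc _ ≤ 2 * B + (|x| / θ) * (2 * B) := by gcongr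
        _ = 2 * B + (2 * B / θ) * |x| := by ring
        _ ≤ 2 * B * (1 + x ^ 2) + (2 * B / θ) * (1 + x ^ 2) := by
          refine add_le_add ?_ (by gcongr)
          nlinarith [sq_nonneg x, mul_nonneg B0 (sq_nonneg x)]
        _ ≤ _ := by
          have : 0 ≤ (2 * B + 2 * B / θ) * (1 + x ^ 2) := by positivity
          linarith
    calc _ ≤ (B * ((2 * B + 2 * B / θ) * 2 * (1 + x ^ 2))) * ((√(θ / 2))⁻¹ * exp (-x ^ 2 / (8 * θ))) := by
          have := Gk_pos hp x
          gcongr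
      _ = _ := by unfold Dom; ring
  · refine Eventually.of_forall fun x => ?_
    have t1 : Tendsto (slope (fun s => V s x) t) (nhdsWithin t {t}ᶜ) (nhds (Vt t x)) :=
      hasDerivAt_iff_tendsto_slope.1 (h.dt t ht x)
    have t2 : Tendsto (fun s => Vxx s x) (nhdsWithin t {t}ᶜ) (nhds (Vxx t x)) :=
      (h.txx t ht x).tendsto.mono_left nhdsWithin_le_nhds
    have t3 : Tendsto (fun s => Vx s x) (nhdsWithin t {t}ᶜ) (nhds (Vx t x)) :=
      (h.tx t ht x).tendsto.mono_left nhdsWithin_le_nhds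
    have t4' : ContinuousAt (fun s => x / (2 * (tb - s + a))) t :=
      ContinuousAt.div (by fun_prop) (by fun_prop) (by positivity)
    have t4 : Tendsto (fun s => x / (2 * (tb - s + a))) (nhdsWithin t {t}ᶜ) (nhds (x / (2 * θ))) :=
      t4'.tendsto.mono_left nhdsWithin_le_nhds
    have t5' : ContinuousAt (fun s => Gk (tb - s + a) x) t :=
      ContinuousAt.comp (g := fun θ => Gk θ x) (f := fun s => tb - s + a) (Gk_dθ hθ x).continuousAt (by fun_prop)
    have t5 : Tendsto (fun s => Gk (tb - s + a) x) (nhdsWithin t {t}ᶜ) (nhds (Gk θ x)) :=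
      t5'.tendsto.mono_left nhdsWithin_le_nhds
    have := ((t1.mul ((t2.add_const (Vxx t x)).sub (t4.mul (t3.add_const (Vx t x))))).neg).mul t5
    refine Tendsto.congr' (Eventually.of_forall fun s => rfl) (this.trans ?_)
    apply le_of_eq; congr 1; ring
end

end

section
open MeasureTheory

section
variable {V Vt Vx Vxx : ℝ → ℝ → ℝ} {p q C B : ℝ}

theorem Loc.D' (h : Loc V Vt Vx Vxx p q C B) {t : ℝ} (ht : t ∈ Ioo p q) {tb a : ℝ}
    (hθ : 0 < tb - t + a) :
    HasDerivAt (fun s => II (tb - s + a) (fun x => Vx s x * Vx s x))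
      (-2 * II (tb - t + a) (fun x => (Vxx t x - x / (2 * (tb - t + a)) * Vx t x) *
          (Vxx t x - x / (2 * (tb - t + a)) * Vx t x))
        + (1 / (tb - t + a)) * II (tb - t + a) (fun x => Vx t x * Vx t x)
        + (-2) * II (tb - t + a) (fun x => (Vt t x - Vxx t x) * (Vxx t x - x / (2 * (tb - t + a)) * Vx t x))) t := by
  have B0 : 0 ≤ B := (abs_nonneg _).trans (h.b t ht 0)
  have k2 := dint (K := B * B) hθ ht (A := fun s x => Vx t x * Vx t x)
    (At := fun s x => 0) (fun s hs => ((h.gx ht).mul (h.gx ht)).1) continuous_const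
    (fun s hs x => hasDerivAt_const _ _) (fun s hs x => by
      rw [abs_mul]; exact mul_le_mul (h.bx t ht x) (h.bx t ht x) (abs_nonneg _) B0) 
    (fun s hs x => by rw [abs_zero]; positivity)
  have k1 := h.D1' ht hθ
  have k := k1.add k2
  have hev : (fun s => II (tb - s + a) (fun x => Vx s x * Vx s x)) =ᶠ[nhds t]
      (fun s => II (tb - s + a) (fun x => Vx s x * Vx s x - Vx t x * Vx t x)) +
      (fun s => ∫ x, Vx t x * Vx t x * Gk (tb - s + a) x) := by
    have e1 : ∀ᶠ s in nhds t, 0 < tb - s + a :=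
      (by fun_prop : Continuous fun s : ℝ => tb - s + a).continuousAt.eventually_const_lt hθ
    have e2 : ∀ᶠ s in nhds t, s ∈ Ioo p q := Ioo_mem_nhds ht.1 ht.2
    filter_upwards [e1, e2] with s hp hs
    simp only [Pi.add_apply]
    have g2 : Gr 2 (fun x => Vx s x * Vx s x - Vx t x * Vx t x) :=
      (((h.gx hs).mul (h.gx hs)).sub ((h.gx ht).mul (h.gx ht))).mono (by norm_num)
    have := II_add hp g2 (((h.gx ht).mul (h.gx ht)).mono (by norm_num))
    simp only [sub_add_cancel] at this
    exact this
  refine (k.congr_of_eventuallyEq hev).congr_deriv ?_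
  set θ := tb - t + a
  have g0 := h.g0 ht
  have gx := h.gx ht
  have gxx := h.gxx ht
  have gt := h.gt ht
  have gf := h.gf ht
  have gL := h.gL ht θ
  have i := II_ibp hθ (F := fun x => x / (2 * θ) * (-(1:ℝ) * (Vx t x * Vx t x)))
    (F' := fun x => (1 / (2 * θ)) * (-(1:ℝ) * (Vx t x * Vx t x)) + x / (2 * θ) * (-2 * (Vx t x * Vxx t x))) 
    (fun x => by
      have d2 := h.dxx t ht x
      have := (((hasDerivAt_id x).div_const (2 * θ)).mul ((d2.mul d2).const_mul (-1)))
      refine this.congr_deriv ?_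
      simp only [id, Pi.mul_apply]
      ring) (((gx.mul gx).cmul (-1)).xdiv θ) 
    ((((((gx.mul gx).cmul (-1)).cmul _).mono (by norm_num)).add (((gx.mul gxx).cmul (-2)).xdiv θ)).mono (by norm_num))
  have ga : Gr 2 (fun x => -2 * ((Vxx t x - x / (2 * θ) * Vx t x) * (Vxx t x - x / (2 * θ) * Vx t x))) :=
    (gL.mul gL).cmul _
  have gb : Gr 2 (fun x => (1 / θ) * (Vx t x * Vx t x)) := ((gx.mul gx).cmul _).mono (by norm_num)
  have gc : Gr 2 (fun x => (-2) * ((Vt t x - Vxx t x) * (Vxx t x - x / (2 * θ) * Vx t x))) :=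
    ((gf.mul gL).cmul _).mono (by norm_num)
  have gd : Gr 2 (fun x => -(Vt t x * (2 * (Vxx t x - x / (2 * θ) * Vx t x)))) := by
    have := ((gt.mul gL).cmul (-2)).mono (m := 2) (by norm_num)
    convert this using 2; ring
  have ge : Gr 2 (fun x => 0 - (x ^ 2 / (4 * θ ^ 2) - 1 / (2 * θ)) * (Vx t x * Vx t x)) := by
    have := (((gx.mul gx).xdiv θ).xdiv θ).cmul (-1)
    have := this.add (((gx.mul gx).cmul (1 / (2 * θ))).mono (by norm_num))
    convert this using 2; field_simp; ring
  have gi := ((((((gx.mul gx).cmul (-1)).cmul (1 / (2 * θ))).mono (m := 2) (by norm_num)).add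
    ((((gx.mul gxx).cmul (-2)).xdiv θ).mono (by norm_num)))).sub
    ((((gx.mul gx).cmul (-1)).xdiv θ).xdiv θ)
  rw [← II_cmul, ← II_cmul, ← II_cmul, ← II_add hθ ga gb, ← II_add hθ (ga.add gb) gc]
  change II θ _ + II θ _ = _
  rw [← II_add hθ gd ge]
  refine Eq.trans ?_ ((congrArg (fun y => II θ _ + y) i).trans (add_zero _))
  rw [← II_add hθ ((ga.add gb).add gc) gi]
  unfold II
  congr 1; ext x
  congr 1
  field_simp
  ring

/-- the main differential inequalities, abstracted -/
theorem Loc.est (h : Loc V Vt Vx Vxx p q C B) {t : ℝ} (ht : t ∈ Ioo p q) {tb a : ℝ}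
    (hθ : 0 < tb - t + a) :
    ∃ H' D', HasDerivAt (fun s => II (tb - s + a) (fun x => V s x * V s x)) H' t ∧
      HasDerivAt (fun s => II (tb - s + a) (fun x => Vx s x * Vx s x)) D' t ∧
      0 < II (tb - t + a) (fun x => V t x * V t x) ∧
      0 ≤ II (tb - t + a) (fun x => Vx t x * Vx t x) ∧
      -(2 + C) * II (tb - t + a) (fun x => Vx t x * Vx t x)
        - 3 * C * II (tb - t + a) (fun x => V t x * V t x) ≤ H' ∧
      (-II (tb - t + a) (fun x => Vx t x * Vx t x) + (tb - t + a) * D')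
          * II (tb - t + a) (fun x => V t x * V t x)
        - (tb - t + a) * II (tb - t + a) (fun x => Vx t x * Vx t x) * H'
        ≤ C ^ 2 * (tb - t + a) * (II (tb - t + a) (fun x => V t x * V t x) +
          II (tb - t + a) (fun x => Vx t x * Vx t x)) * II (tb - t + a) (fun x => V t x * V t x) := by
  refine ⟨_, _, h.H' ht hθ, h.D' ht hθ, ?_⟩
  set θ := tb - t + a
  have g0 := h.g0 ht
  have gx := h.gx ht
  have gf := h.gf ht
  have gL := h.gL ht θ
  have C0 := h.C0
  have hH : 0 < II θ (fun x => V t x * V t x) := by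
    obtain ⟨x, hx⟩ := h.nz t ht
    exact II_pos hθ ((g0.mul g0).mono (by norm_num)) (fun x => mul_self_nonneg _) ⟨x, mul_ne_zero hx hx⟩
  have hD : 0 ≤ II θ (fun x => Vx t x * Vx t x) := II_nonneg hθ (fun x => mul_self_nonneg _)
  have hDL := h.ibp1 ht hθ
  have cs := II_cs hθ (F := V t) (F' := fun x => (Vxx t x - x / (2 * θ) * Vx t x) + (1/2) * (Vt t x - Vxx t x))
    (g0.mono (by norm_num)) (gL.add ((gf.cmul _).mono (by norm_num)))
  have e1 : II θ (fun x => V t x * ((Vxx t x - x / (2 * θ) * Vx t x) + (1/2) * (Vt t x - Vxx t x)))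
      = II θ (fun x => V t x * (Vxx t x - x / (2 * θ) * Vx t x)) + (1/2) * II θ (fun x => V t x * (Vt t x - Vxx t x)) := by
    rw [← II_cmul, ← II_add hθ ((g0.mul gL).mono (by norm_num)) (((g0.mul gf).cmul _).mono (by norm_num))]
    congr 1; ext x; ring
  have e2 : II θ (fun x => ((Vxx t x - x / (2 * θ) * Vx t x) + (1/2) * (Vt t x - Vxx t x)) *
      ((Vxx t x - x / (2 * θ) * Vx t x) + (1/2) * (Vt t x - Vxx t x)))
      = II θ (fun x => (Vxx t x - x / (2 * θ) * Vx t x) * (Vxx t x - x / (2 * θ) * Vx t x)) +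
        II θ (fun x => (Vt t x - Vxx t x) * (Vxx t x - x / (2 * θ) * Vx t x)) +
        (1/4) * II θ (fun x => (Vt t x - Vxx t x) * (Vt t x - Vxx t x)) := by
    rw [← II_cmul, ← II_add hθ ((gL.mul gL).mono (by norm_num)) ((gf.mul gL).mono (by norm_num)),
      ← II_add hθ (((gL.mul gL).mono (by norm_num)).add ((gf.mul gL).mono (by norm_num)))
        (((gf.mul gf).cmul _).mono (by norm_num))]
    congr 1; ext x; ring
  have hF : II θ (fun x => (Vt t x - Vxx t x) * (Vt t x - Vxx t x)) ≤
      2 * C ^ 2 * (II θ (fun x => V t x * V t x) + II θ (fun x => Vx t x * Vx t x)) := by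
    rw [← II_add hθ ((g0.mul g0).mono (by norm_num)) ((gx.mul gx).mono (by norm_num)), ← II_cmul]
    refine II_mono hθ ((gf.mul gf).mono (by norm_num)) ((((g0.mul g0).add (gx.mul gx)).cmul _).mono (by norm_num)) ?_
    intro x
    have i := h.ineq t ht x
    have a0 := abs_nonneg (Vt t x - Vxx t x)
    have : |Vt t x - Vxx t x| * |Vt t x - Vxx t x| ≤ (C * (|V t x| + |Vx t x|)) * (C * (|V t x| + |Vx t x|)) :=
      mul_le_mul i i a0 (a0.trans i)
    rw [abs_mul_abs_self] at this
    have k : (|V t x| + |Vx t x|) * (|V t x| + |Vx t x|) ≤ 2 * (V t x * V t x + Vx t x * Vx t x) := by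
      rw [← abs_mul_abs_self (V t x), ← abs_mul_abs_self (Vx t x)]
      nlinarith [sq_nonneg (|V t x| - |Vx t x|)]
    have := mul_le_mul_of_nonneg_left k (sq_nonneg C)
    nlinarith
  have hR : -(C * (3 / 2 * II θ (fun x => V t x * V t x) + 1 / 2 * II θ (fun x => Vx t x * Vx t x))) ≤ 
      II θ (fun x => V t x * (Vt t x - Vxx t x)) := by
    have : II θ (fun x => (-C) * (3 / 2 * (V t x * V t x) + 1 / 2 * (Vx t x * Vx t x))) ≤ 
      II θ (fun x => V t x * (Vt t x - Vxx t x)) := by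
      refine II_mono hθ ((((g0.mul g0).cmul _).add ((gx.mul gx).cmul _)).cmul _ |>.mono (by norm_num))
        ((g0.mul gf).mono (by norm_num)) ?_
      intro x
      have i := h.ineq t ht x
      have i2 : |V t x * (Vt t x - Vxx t x)| ≤ |V t x| * (C * (|V t x| + |Vx t x|)) := by
        rw [abs_mul]; gcongr
      have i3 := neg_abs_le (V t x * (Vt t x - Vxx t x))
      have k : |V t x| * (|V t x| + |Vx t x|) ≤ (3 / 2 * (V t x * V t x) + 1 / 2 * (Vx t x * Vx t x)) := by
        rw [← abs_mul_abs_self (V t x), ← abs_mul_abs_self (Vx t x)]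
        nlinarith [sq_nonneg (|V t x| - |Vx t x|)]
      have := mul_le_mul_of_nonneg_left k C0
      nlinarith
    rw [II_cmul, II_add hθ (((g0.mul g0).cmul _).mono (by norm_num)) (((gx.mul gx).cmul _).mono (by norm_num)),
      II_cmul, II_cmul] at this
    linarith
  rw [e1, e2] at cs
  set H := II θ (fun x => V t x * V t x)
  set D := II θ (fun x => Vx t x * Vx t x)
  set R := II θ (fun x => V t x * (Vt t x - Vxx t x))
  set P := II θ (fun x => (Vxx t x - x / (2 * θ) * Vx t x) * (Vxx t x - x / (2 * θ) * Vx t x))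
  set Q := II θ (fun x => (Vt t x - Vxx t x) * (Vxx t x - x / (2 * θ) * Vx t x))
  set F2 := II θ (fun x => (Vt t x - Vxx t x) * (Vt t x - Vxx t x))
  set S := II θ (fun x => V t x * (Vxx t x - x / (2 * θ) * Vx t x))
  refine ⟨hH, hD, by linarith, ?_⟩
  have e : (-D + θ * (-2 * P + 1 / θ * D + -2 * Q)) * H - θ * D * (-2 * D + 2 * R)
      = θ * (2 * D ^ 2 - 2 * D * R - 2 * (P + Q) * H) := by field_simp; ring
  rw [e]
  have hS : S = -D := by linarith
  rw [hS] at cs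
  have m1 : 2 * D ^ 2 - 2 * D * R - 2 * (P + Q) * H ≤ H * F2 / 2 := by nlinarith [sq_nonneg R]
  have m2 : H * F2 / 2 ≤ C ^ 2 * (H + D) * H := by nlinarith
  have := mul_le_mul_of_nonneg_left (m1.trans m2) hθ.le
  linarith
end

end

section
open MeasureTheory

section
variable {V Vt Vx Vxx : ℝ → ℝ → ℝ} {p q C B : ℝ}

/-- lower bound with uniform constants, given bound on the frequency at initial time -/
theorem Loc.lower (h : Loc V Vt Vx Vxx p q C B) {ta tb a N0 : ℝ} (h1 : p < ta) (h2 : ta < tb)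
    (h3 : tb < q) (ha : 0 < a) (ha1 : a ≤ 1)
    (hN : (tb - ta + a) * II (tb - ta + a) (fun x => Vx ta x * Vx ta x) ≤
      N0 * II (tb - ta + a) (fun x => V ta x * V ta x)) (n : ℕ)
    (hn : (2 + C) * ((N0 + (tb - ta + 1)) * exp (C ^ 2 * (tb - ta))) ≤ n) :
    a ^ n * (II (tb - ta + a) (fun x => V ta x * V ta x) * ((tb - ta + 1) ^ n)⁻¹ * exp (-(3 * C * (tb - ta))))
      ≤ II a (fun x => V tb x * V tb x) := by
  have hmem : ∀ t ∈ Icc ta tb, t ∈ Ioo p q := fun t ht => ⟨by linarith [ht.1], by linarith [ht.2]⟩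
  have hpos : ∀ t ∈ Icc ta tb, 0 < tb - t + a := fun t ht => by linarith [ht.2]
  have C0 := h.C0
  choose! H' D' e1 e2 e3 e4 e5 e6 using fun t (ht : t ∈ Icc ta tb) => h.est (hmem t ht) (hpos t ht)
  set H := fun s => II (tb - s + a) (fun x => V s x * V s x) with hH
  set D := fun s => II (tb - s + a) (fun x => Vx s x * Vx s x) with hD
  set Θ := tb - ta + 1 with hΘ
  have dθ : ∀ s, HasDerivAt (fun s => tb - s + a) (-1) s := fun s => by
    simpa using ((hasDerivAt_id s).const_sub tb).add_const a
  -- frequency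
  have an : AntitoneOn (fun s => ((tb - s + a) * D s / H s + Θ) * exp (-(C ^ 2) * s)) (Icc ta tb) := by
    have hd : ∀ t ∈ Icc ta tb, HasDerivAt (fun s => ((tb - s + a) * D s / H s + Θ) * exp (-(C ^ 2) * s))
        ((((-1 * D t + (tb - t + a) * D' t) * H t - (tb - t + a) * D t * H' t) / H t ^ 2) * exp (-(C ^ 2) * t)
          + ((tb - t + a) * D t / H t + Θ) * (exp (-(C ^ 2) * t) * (-(C ^ 2) * 1))) t := fun t ht =>
      (((((dθ t).mul (e2 t ht)).div (e1 t ht) (e3 t ht).ne').add_const Θ).mul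
        (((hasDerivAt_id t).const_mul (-(C ^ 2))).exp))
    refine antitoneOn_of_hasDerivWithinAt_nonpos (convex_Icc _ _)
      (fun t ht => (hd t ht).continuousAt.continuousWithinAt)
      (fun t ht => (hd t (interior_subset ht)).hasDerivWithinAt) ?_
    intro t ht
    have ht := interior_subset ht
    have hp := hpos t ht
    have k3 : 0 < H t := e3 t ht
    have k4 : 0 ≤ D t := e4 t ht
    have k6 := e6 t ht
    have hx := exp_pos (-(C ^ 2) * t)
    have k : ((-1 * D t + (tb - t + a) * D' t) * H t - (tb - t + a) * D t * H' t) / H t ^ 2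
        ≤ C ^ 2 * ((tb - t + a) * D t / H t + Θ) := by
      rw [div_le_iff₀ (by positivity)]
      have : C ^ 2 * ((tb - t + a) * D t / H t + Θ) * H t ^ 2 =
        C ^ 2 * (((tb - t + a) * D t) * H t + Θ * H t ^ 2) := by field_simp
      rw [this]
      have : (tb - t + a) * H t ^ 2 ≤ Θ * H t ^ 2 := by
        gcongr; linarith [ht.1]
      have := mul_le_mul_of_nonneg_left this (sq_nonneg C)
      change (-D t + (tb - t + a) * D' t) * H t - (tb - t + a) * D t * H' t ≤
        C ^ 2 * (tb - t + a) * (H t + D t) * H t at k6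
      nlinarith
    have := mul_le_mul_of_nonneg_right k hx.le
    nlinarith
  have Ta : ta ∈ Icc ta tb := ⟨le_rfl, h2.le⟩
  have Tb : tb ∈ Icc ta tb := ⟨h2.le, le_rfl⟩
  have hfreq : ∀ t ∈ Icc ta tb, (tb - t + a) * D t ≤ ((N0 + Θ) * exp (C ^ 2 * (tb - ta))) * H t := by
    intro t ht
    have k3 : 0 < H t := e3 t ht
    have k30 : 0 < H ta := e3 ta Ta
    have k4 : 0 ≤ D ta := e4 ta Ta
    have m := an Ta ht ht.1
    simp only at m
    have q0 : (tb - ta + a) * D ta / H ta ≤ N0 := by rw [div_le_iff₀ k30]; exact hN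
    have q1 : 0 ≤ (tb - ta + a) * D ta / H ta := by
      have := hpos ta Ta; positivity
    have q2 : 0 ≤ N0 + Θ := by linarith
    have hx := exp_pos (-(C ^ 2) * t)
    have m2 : ((tb - t + a) * D t / H t + Θ) * exp (-(C ^ 2) * t) ≤ (N0 + Θ) * exp (-(C ^ 2) * ta) :=
      m.trans (by gcongr)
    have e : exp (-(C ^ 2) * ta) = exp (C ^ 2 * (t - ta)) * exp (-(C ^ 2) * t) := by
      rw [← exp_add]; congr 1; ring
    rw [e, ← mul_assoc] at m2
    have m3 := le_of_mul_le_mul_right m2 hx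
    have m4 : exp (C ^ 2 * (t - ta)) ≤ exp (C ^ 2 * (tb - ta)) := by
      apply exp_le_exp.2; gcongr; exact ht.2
    have m5 := mul_le_mul_of_nonneg_left m4 q2
    rw [← div_le_iff₀ k3]
    linarith
  -- lower bound
  have mo : MonotoneOn (fun s => H s * ((tb - s + a) ^ n)⁻¹ * exp (3 * C * s)) (Icc ta tb) := by
    have hd : ∀ t ∈ Icc ta tb, HasDerivAt (fun s => H s * ((tb - s + a) ^ n)⁻¹ * exp (3 * C * s))
        ((H' t * ((tb - t + a) ^ n)⁻¹ + H t * (-(n * (tb - t + a) ^ (n - 1) * (-1)) / ((tb - t + a) ^ n) ^ 2))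
           * exp (3 * C * t)
          + H t * ((tb - t + a) ^ n)⁻¹ * (exp (3 * C * t) * (3 * C * 1))) t := fun t ht =>
      (((e1 t ht).mul (((dθ t).fun_pow n).fun_inv (pow_pos (hpos t ht) n).ne')).mul
        (((hasDerivAt_id t).const_mul (3 * C)).exp))
    refine monotoneOn_of_hasDerivWithinAt_nonneg (convex_Icc _ _)
      (fun t ht => (hd t ht).continuousAt.continuousWithinAt)
      (fun t ht => (hd t (interior_subset ht)).hasDerivWithinAt) ?_
    intro t ht
    have ht := interior_subset ht
    have hp := hpos t ht
    have k3 : 0 < H t := e3 t ht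
    have k4 : 0 ≤ D t := e4 t ht
    have k5 : -(2 + C) * D t - 3 * C * H t ≤ H' t := e5 t ht
    have hx := exp_pos (3 * C * t)
    have e : -(n * (tb - t + a) ^ (n - 1) * (-1)) / ((tb - t + a) ^ n) ^ 2
      = (n / (tb - t + a)) * ((tb - t + a) ^ n)⁻¹ := by
      rcases n with _ | n
      · simp
      · simp only [Nat.add_sub_cancel, pow_succ]
        field_simp
    rw [e]
    have f := hfreq t ht
    have f1 : (2 + C) * D t ≤ (n / (tb - t + a)) * H t := by
      rw [div_mul_eq_mul_div, le_div_iff₀ hp]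
      have := mul_le_mul_of_nonneg_left f (by linarith : 0 ≤ 2 + C)
      have := mul_le_mul_of_nonneg_right hn k3.le
      linarith
    have g : 0 ≤ H' t + (n / (tb - t + a)) * H t + 3 * C * H t := by linarith
    have hp' : 0 < ((tb - t + a) ^ n)⁻¹ := by positivity
    have := mul_nonneg g (mul_pos hp' hx).le
    linarith
  have m := mo Ta Tb h2.le
  simp only [sub_self, zero_add] at m
  have hHa : H tb = II a (fun x => V tb x * V tb x) := by simp [hH]
  rw [← hHa]
  have k30 : 0 < H ta := e3 ta Ta
  have hp : 0 < tb - ta + a := hpos ta Ta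
  have an : 0 < a ^ n := by positivity
  have e : exp (-(3 * C * (tb - ta))) = exp (3 * C * ta) * exp (-(3 * C * tb)) := by
    rw [← exp_add]; congr 1; ring
  have e' : exp (3 * C * tb) * exp (-(3 * C * tb)) = 1 := by
    rw [← exp_add]; simp
  have i1 : (Θ ^ n)⁻¹ ≤ ((tb - ta + a) ^ n)⁻¹ := by
    apply inv_anti₀ (by positivity)
    exact pow_le_pow_left₀ hp.le (by linarith) n
  calc a ^ n * (H ta * (Θ ^ n)⁻¹ * exp (-(3 * C * (tb - ta)))) 
      ≤ a ^ n * (H ta * ((tb - ta + a) ^ n)⁻¹ * exp (-(3 * C * (tb - ta)))) := by gcongr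
    _ = a ^ n * ((H ta * ((tb - ta + a) ^ n)⁻¹ * exp (3 * C * ta)) * exp (-(3 * C * tb))) := by rw [e]; ring
    _ ≤ a ^ n * ((H tb * (a ^ n)⁻¹ * exp (3 * C * tb)) * exp (-(3 * C * tb))) := by gcongr
    _ = a ^ n * (H tb * (a ^ n)⁻¹ * (exp (3 * C * tb) * exp (-(3 * C * tb)))) := by ring
    _ = H tb := by rw [e']; field_simp

theorem II_small {F : ℝ → ℝ} {K r a : ℝ} (ha : 0 < a) (hF : Continuous F) (h0 : ∀ x, 0 ≤ F x)
    (hb : ∀ x, F x ≤ K) (hr : 0 ≤ r) (hz : ∀ x, |x| < r → F x = 0) :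
    II a F ≤ K * (√2 * exp (-(r ^ 2 / (8 * a))) * (2 * √π)) := by
  have K0 : 0 ≤ K := (h0 0).trans (hb 0)
  have e : ∫ x, Gk (2 * a) x = 2 * √π := by
    unfold Gk
    rw [integral_const_mul]
    have := integral_gaussian (1 / (8 * a))
    have e2 : (fun x : ℝ => exp (-x ^ 2 / (4 * (2 * a)))) = fun x => exp (-(1 / (8 * a)) * x ^ 2) := by
      ext x; congr 1; field_simp; ring
    rw [e2, this, show π / (1 / (8 * a)) = 2 ^ 2 * (π * (2 * a)) by field_simp; norm_num,
      Real.sqrt_mul (by norm_num) (π * (2 * a)), Real.sqrt_mul pi_pos.le, Real.sqrt_sq (by norm_num)]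
    have : 0 < √(2 * a) := Real.sqrt_pos.2 (by positivity)
    field_simp
  have gi : Integrable (Gk (2 * a)) := by
    have := int_of_bd (θ := 2 * a) (K := 1) (by positivity) (F := fun _ => 1) continuous_const
      (fun x => by rw [abs_one]; nlinarith [sq_nonneg x])
    simpa using this
  rw [← e, ← mul_assoc, ← integral_const_mul]
  unfold II
  refine integral_mono (int_of_bd (K := K) ha hF ?_) (gi.const_mul _) ?_
  · intro x; rw [abs_of_nonneg (h0 x)]; nlinarith [hb x, sq_nonneg x]
  · intro x
    simp only
    have hG := Gk_pos (by positivity : 0 < 2 * a) x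
    by_cases hx : |x| < r
    · rw [hz x hx]; simp only [zero_mul]; positivity
    · push Not at hx
      have hx2 : r ^ 2 ≤ x ^ 2 := by rw [← sq_abs x]; gcongr
      rw [mul_assoc]
      refine mul_le_mul (hb x) ?_ (Gk_pos ha x).le K0
      unfold Gk
      have s1 : 0 < √a := Real.sqrt_pos.2 ha
      have s2 : 0 < √2 := by positivity
      have : √2 * exp (-(r ^ 2 / (8 * a))) * ((√(2 * a))⁻¹ * exp (-x ^ 2 / (4 * (2 * a))))
        = (√a)⁻¹ * (exp (-(r ^ 2 / (8 * a))) * exp (-x ^ 2 / (4 * (2 * a)))) := by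
        rw [Real.sqrt_mul (by norm_num)]; field_simp
      rw [this, ← exp_add]
      gcongr
      have : -x ^ 2 / (4 * a) = - (x ^ 2 / (8 * a)) + -x ^ 2 / (4 * (2 * a)) := by field_simp; ring
      rw [this]
      gcongr

theorem Loc.ucp0 (h : Loc V Vt Vx Vxx p q C B) {tb r : ℝ} (htb : tb ∈ Ioo p q) (hr : 0 < r)
    (hz : ∀ x, |x| < r → V tb x = 0) : False := by
  obtain ⟨ta, h1, h2⟩ := exists_between htb.1
  have h3 := htb.2
  set T := tb - ta with hT
  have T0 : 0 < T := by linarith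
  have hta : ta ∈ Ioo p q := ⟨h1, by linarith⟩
  have B0 : 0 ≤ B := (abs_nonneg _).trans (h.b tb htb 0)
  have gV : Gr 2 (fun x => V ta x * V ta x) := ((h.g0 hta).mul (h.g0 hta)).mono (by norm_num)
  have gX : Gr 2 (fun x => Vx ta x * Vx ta x) := ((h.gx hta).mul (h.gx hta)).mono (by norm_num)
  set h0 := √T / √(T + 1) * II T (fun x => V ta x * V ta x) with hh0
  set d0 := √(T + 1) / √T * II (T + 1) (fun x => Vx ta x * Vx ta x) with hd0
  have s1 : 0 < √T := Real.sqrt_pos.2 T0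
  have s2 : 0 < √(T + 1) := Real.sqrt_pos.2 (by linarith)
  have h0p : 0 < h0 := by
    have : 0 < II T (fun x => V ta x * V ta x) := by
      obtain ⟨x, hx⟩ := h.nz ta hta
      exact II_pos T0 gV (fun x => mul_self_nonneg _) ⟨x, mul_ne_zero hx hx⟩
    positivity
  have d0p : 0 ≤ d0 := by
    have : 0 ≤ II (T + 1) (fun x => Vx ta x * Vx ta x) := II_nonneg (by linarith) (fun x => mul_self_nonneg _)
    positivity
  set N0 := (T + 1) * d0 / h0 with hN0
  have N0p : 0 ≤ N0 := by positivity
  obtain ⟨n, hn⟩ := exists_nat_ge ((2 + C) * ((N0 + (tb - ta + 1)) * exp (C ^ 2 * (tb - ta))))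
  set c := h0 * ((tb - ta + 1) ^ n)⁻¹ * exp (-(3 * C * (tb - ta))) with hc
  have cp : 0 < c := by
    have : 0 < tb - ta + 1 := by linarith
    positivity
  set K := B * B * (√2 * (2 * √π)) with hK
  have main : ∀ a, 0 < a → a ≤ 1 → a ^ n * c ≤ K * exp (-(r ^ 2 / (8 * a))) := by
    intro a ha ha1
    have q1 := (II_le T0 (by linarith : T ≤ T + a) (by linarith : T + a ≤ T + 1) gV (fun x => mul_self_nonneg _)).2
    have q2 := (II_le T0 (by linarith : T ≤ T + a) (by linarith : T + a ≤ T + 1) gX (fun x => mul_self_nonneg _)).1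
    have hN : (T + a) * II (T + a) (fun x => Vx ta x * Vx ta x) ≤ N0 * II (T + a) (fun x => V ta x * V ta x) := by
      calc _ ≤ (T + 1) * d0 := by
            apply mul_le_mul (by linarith) q2 (II_nonneg (by linarith) (fun x => mul_self_nonneg _)) (by linarith)
        _ = N0 * h0 := by rw [hN0]; field_simp
        _ ≤ _ := mul_le_mul_of_nonneg_left q1 N0p
    have lo := h.lower h1 h2 h3 ha ha1 hN n hn
    have up := II_small (F := fun x => V tb x * V tb x) (K := B * B) ha ((h.g0 htb).mul (h.g0 htb)).1
      (fun x => mul_self_nonneg _) (fun x => by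
        rw [← abs_mul_abs_self]; exact mul_le_mul (h.b tb htb x) (h.b tb htb x) (abs_nonneg _) B0) hr.le
      (fun x hx => by simp [hz x hx])
    have : a ^ n * c ≤ a ^ n * (II (tb - ta + a) (fun x => V ta x * V ta x) * ((tb - ta + 1) ^ n)⁻¹ * exp (-(3 * C * (tb - ta)))) := by
      rw [hc]
      have : 0 < tb - ta + 1 := by linarith
      gcongr
    refine (this.trans lo).trans (up.trans (le_of_eq ?_))
    rw [hK]; ring
  have lim := (tendsto_rpow_mul_exp_neg_mul_atTop_nhds_zero n (r ^ 2 / 8) (by positivity)).const_mul K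
  rw [mul_zero] at lim
  have ev := (lim.eventually_lt_const cp).and (eventually_ge_atTop 1)
  obtain ⟨y, hy, hy1⟩ := ev.exists
  have y0 : 0 < y := by linarith
  have m := main y⁻¹ (by positivity) (inv_le_one_of_one_le₀ hy1)
  have e : r ^ 2 / (8 * y⁻¹) = r ^ 2 / 8 * y := by field_simp
  rw [e] at m
  rw [Real.rpow_natCast] at hy
  have : c ≤ K * (y ^ n * exp (-(r ^ 2 / 8) * y)) := by
    rw [inv_pow, inv_mul_le_iff₀ (by positivity)] at m
    rw [neg_mul]; refine m.trans (le_of_eq ?_); ring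
  linarith

theorem Loc.ucp (h : Loc V Vt Vx Vxx p q C B) {tb x0 r : ℝ} (htb : tb ∈ Ioo p q) (hr : 0 < r)
    (hz : ∀ x, |x - x0| < r → V tb x = 0) : False := by
  have h' : Loc (fun t x => V t (x + x0)) (fun t x => Vt t (x + x0)) (fun t x => Vx t (x + x0))
      (fun t x => Vxx t (x + x0)) p q C B := by
    refine ⟨fun t ht => (h.ct t ht).comp (by fun_prop), fun t ht => (h.cxx t ht).comp (by fun_prop),
      fun t ht x => h.tx t ht _, fun t ht x => h.txx t ht _, fun t ht x => h.dt t ht _,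
      fun t ht x => (h.dx t ht _).comp_add_const x x0, fun t ht x => (h.dxx t ht _).comp_add_const x x0,
      fun t ht x => h.b t ht _, fun t ht x => h.bt t ht _,
      fun t ht x => h.bx t ht _, fun t ht x => h.bxx t ht _, h.C0, fun t ht x => h.ineq t ht _, ?_⟩
    intro t ht
    obtain ⟨x, hx⟩ := h.nz t ht
    exact ⟨x - x0, by simpa using hx⟩
  exact h'.ucp0 htb hr fun x hx => hz _ (by simpa using hx)
end

end

section

section
variable {v vt vx vxx : ℝ → ℝ → ℝ}

theorem cont_slice_x {w : ℝ → ℝ → ℝ}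
    (h : ContinuousOn (fun p : ℝ × ℝ => w p.1 p.2) (Set.Ioi 0 ×ˢ Set.univ)) {t : ℝ} (ht : 0 < t) :
    Continuous (w t) := by
  refine continuous_iff_continuousAt.2 fun x => ?_
  have : ContinuousAt (fun p : ℝ × ℝ => w p.1 p.2) (t, x) :=
    h.continuousAt (prod_mem_nhds (Ioi_mem_nhds ht) univ_mem)
  exact ContinuousAt.comp (g := fun p : ℝ × ℝ => w p.1 p.2) (f := fun y : ℝ => (t, y)) this (by fun_prop)

theorem cont_slice_t {w : ℝ → ℝ → ℝ}
    (h : ContinuousOn (fun p : ℝ × ℝ => w p.1 p.2) (Set.Ioi 0 ×ˢ Set.univ)) {t : ℝ} (ht : 0 < t) (x : ℝ) :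
    ContinuousAt (fun s => w s x) t := by
  have : ContinuousAt (fun p : ℝ × ℝ => w p.1 p.2) (t, x) :=
    h.continuousAt (prod_mem_nhds (Ioi_mem_nhds ht) univ_mem)
  exact ContinuousAt.comp (g := fun p : ℝ × ℝ => w p.1 p.2) (f := fun s : ℝ => (s, x)) this (by fun_prop)

theorem bound_per {w : ℝ → ℝ → ℝ}
    (h : ContinuousOn (fun p : ℝ × ℝ => w p.1 p.2) (Set.Ioi 0 ×ˢ Set.univ))
    (hper : ∀ t > (0:ℝ), ∀ x, w t (x + 2 * π) = w t x) {p q : ℝ} (hp : 0 < p) :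
    ∃ B, ∀ t ∈ Icc p q, ∀ x, |w t x| ≤ B := by
  have hK : IsCompact (Icc p q ×ˢ Icc (0:ℝ) (2 * π)) := isCompact_Icc.prod isCompact_Icc
  obtain ⟨B, hB⟩ := hK.exists_bound_of_continuousOn (h.mono (fun z hz => ⟨hp.trans_le hz.1.1, mem_univ _⟩))
  refine ⟨B, fun t ht x => ?_⟩
  obtain ⟨n, hn⟩ := exists_shift x
  have ht0 : 0 < t := hp.trans_le ht.1
  have e : w t (x + n * (2 * π)) = w t x := by
    have : Function.Periodic (w t) (2 * π) := hper t ht0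
    exact this.int_mul n x
  rw [← e]
  exact hB (t, _) ⟨ht, hn⟩

theorem Sol.per_t (S : Sol v vt vx vxx) : ∀ t > (0:ℝ), ∀ x, vt t (x + 2 * π) = vt t x := by
  intro t ht x
  refine (S.dt t ht (x + 2 * π)).unique ((S.dt t ht x).congr_of_eventuallyEq ?_)
  filter_upwards [Ioi_mem_nhds ht] with s hs using S.per s hs x

theorem Sol.per_x (S : Sol v vt vx vxx) : ∀ t > (0:ℝ), ∀ x, vx t (x + 2 * π) = vx t x := by
  intro t ht x
  refine HasDerivAt.unique ((S.dx t ht (x + 2 * π)).comp_add_const x (2 * π))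
    ((S.dx t ht x).congr_of_eventuallyEq ?_)
  exact Eventually.of_forall fun y => S.per t ht y

theorem Sol.per_xx (S : Sol v vt vx vxx) : ∀ t > (0:ℝ), ∀ x, vxx t (x + 2 * π) = vxx t x := by
  intro t ht x
  refine HasDerivAt.unique ((S.dxx t ht (x + 2 * π)).comp_add_const x (2 * π))
    ((S.dxx t ht x).congr_of_eventuallyEq ?_)
  exact Eventually.of_forall fun y => S.per_x t ht y

theorem Sol.bound (S : Sol v vt vx vxx) {p q : ℝ} (hp : 0 < p) : ∃ B, ∀ t ∈ Icc p q, ∀ x,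
    |v t x| ≤ B ∧ |vt t x| ≤ B ∧ |vx t x| ≤ B ∧ |vxx t x| ≤ B := by
  obtain ⟨a, ha⟩ := bound_per S.cv S.per (q := q) hp
  obtain ⟨b, hb⟩ := bound_per S.ct S.per_t (q := q) hp
  obtain ⟨c, hc⟩ := bound_per S.cx S.per_x (q := q) hp
  obtain ⟨d, hd⟩ := bound_per S.cxx S.per_xx (q := q) hp
  refine ⟨max (max a b) (max c d), fun t ht x => ⟨?_, ?_, ?_, ?_⟩⟩
  · exact (ha t ht x).trans (by simp)
  · exact (hb t ht x).trans (by simp)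
  · exact (hc t ht x).trans (by simp)
  · exact (hd t ht x).trans (by simp)

theorem Sol.ineq' (S : Sol v vt vx vxx) {η : ℝ} (hη : 0 < η) : ∃ C, 0 ≤ C ∧ ∀ t ≥ η, ∀ x : ℝ,
    |vt t x - vxx t x| ≤ C * (|v t x| + |vx t x|) := by
  obtain ⟨C, hC⟩ := S.ineq η hη
  refine ⟨max C 0, le_max_right _ _, fun t ht x => (hC t ht x).trans ?_⟩
  gcongr; exact le_max_left _ _

theorem Sol.loc (S : Sol v vt vx vxx) {p q : ℝ} (hp : 0 < p) : ∃ C B, Loc v vt vx vxx p q C B := by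
  obtain ⟨C, C0, hC⟩ := S.ineq' hp
  obtain ⟨B, hB⟩ := S.bound (q := q) hp
  have pos : ∀ t ∈ Ioo p q, 0 < t := fun t ht => hp.trans ht.1
  have mem : ∀ t ∈ Ioo p q, t ∈ Icc p q := fun t ht => Ioo_subset_Icc_self ht
  exact ⟨C, B, fun t ht => cont_slice_x S.ct (pos t ht), fun t ht => cont_slice_x S.cxx (pos t ht),
    fun t ht x => cont_slice_t S.cx (pos t ht) x, fun t ht x => cont_slice_t S.cxx (pos t ht) x,
    fun t ht => S.dt t (pos t ht), fun t ht => S.dx t (pos t ht), fun t ht => S.dxx t (pos t ht),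
    fun t ht x => (hB t (mem t ht) x).1, fun t ht x => (hB t (mem t ht) x).2.1,
    fun t ht x => (hB t (mem t ht) x).2.2.1, fun t ht x => (hB t (mem t ht) x).2.2.2, C0,
    fun t ht => hC t ht.1.le, fun t ht => S.nz t (pos t ht)⟩

theorem Sol.no_int (S : Sol v vt vx vxx) {t a b : ℝ} (ht : 0 < t) (hab : a < b) :
    ∃ x ∈ Ioo a b, v t x ≠ 0 := by
  by_contra hcon
  push Not at hcon
  obtain ⟨C, B, L⟩ := S.loc (p := t / 2) (q := t + 1) (by linarith)
  refine L.ucp (tb := t) (x0 := (a + b) / 2) (r := (b - a) / 2) ⟨by linarith, by linarith⟩ (by linarith) ?_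
  intro x hx
  rw [abs_lt] at hx
  exact hcon x ⟨by linarith, by linarith⟩

/-! local analysis at the limit of curves -/

structure CSeq (v : ℝ → ℝ → ℝ) (γ : ℕ → ℝ → ℝ) (t1 t0 : ℝ) : Prop where
  c : ∀ i, Continuous (γ i)
  pos : ∀ i, ∀ s ∈ Icc t1 t0, 0 < v s (γ i s)
  ord : ∀ s ∈ Icc t1 t0, ∀ i j, i < j → γ j s < γ i s
  low : ∀ s ∈ Icc t1 t0, ∀ i, γ 0 s - 2 * π < γ i s
  np : ∀ i j, i ≠ j → ¬ Pos v t0 (γ i t0) (γ j t0)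

theorem CSeq.clash {γ : ℕ → ℝ → ℝ} {t1 t0 : ℝ} (S : Sol v vt vx vxx) (Q : CSeq v γ t1 t0) (h1 : 0 < t1)
    {i j : ℕ} (hij : i ≠ j) {s : ℝ} (hs : s ∈ Icc t1 t0) (hP : Pos v s (γ i s) (γ j s)) : False :=
  Q.np i j hij (S.prop (h1.trans_le hs.1) hs.2 (Q.c i) (Q.c j)
    (fun t ht => Q.pos i t ⟨hs.1.trans ht.1, ht.2⟩) (fun t ht => Q.pos j t ⟨hs.1.trans ht.1, ht.2⟩) hP)

/-- the box hits two different curves -/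
def Hit (γ : ℕ → ℝ → ℝ) (t x δ ε : ℝ) : Prop := ∃ i j, i ≠ j ∧ ∃ s ∈ Ioo (t - δ) (t + δ),
  ∃ s' ∈ Ioo (t - δ) (t + δ), γ i s ∈ Ioo (x - ε) (x + ε) ∧ γ j s' ∈ Ioo (x - ε) (x + ε) ∧ s ≤ s'

theorem CSeq.hit {γ : ℕ → ℝ → ℝ} {t1 t0 : ℝ} (Q : CSeq v γ t1 t0) {t x δ ε : ℝ}
    (hd1 : t1 ≤ t - δ) (hd0 : t + δ ≤ t0) (hx : ∀ i, x ≤ γ i t)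
    (hcl : ∃ s ∈ Ioo (t - δ) (t + δ), ∃ y ∈ Ioo (x - ε) (x + ε), ∃ i, γ i s < y) : Hit γ t x δ ε := by
  obtain ⟨s, hs, y, hy, i, hi⟩ := hcl
  have key : ∀ j, i ≤ j → ∃ σ ∈ Ioo (t - δ) (t + δ), γ j σ ∈ Ioo (x - ε) (x + ε) := by
    intro j hij
    have hj : γ j s < y := by
      rcases hij.eq_or_lt with e | e
      · rwa [← e]
      · exact (Q.ord s ⟨by linarith [hs.1], by linarith [hs.2]⟩ i j e).trans hi
    have hc := Q.c j
    have hφ : Continuous (fun l : ℝ => γ j (t + l * (s - t)) - (x + l * (y - x))) := by fun_prop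
    have := intermediate_value_Icc' (f := fun l : ℝ => γ j (t + l * (s - t)) - (x + l * (y - x)))
      (zero_le_one) hφ.continuousOn
    obtain ⟨l, hl, hl0⟩ := this (show (0:ℝ) ∈ _ by
      constructor
      · simp; linarith
      · simpa using hx j)
    simp only at hl0
    refine ⟨t + l * (s - t), ?_, ?_⟩
    · have a1 : t ∈ Ioo (t - δ) (t + δ) := ⟨by linarith [hs.1, hs.2], by linarith [hs.1, hs.2]⟩
      have := (convex_Ioo (t - δ) (t + δ)) a1 hs (sub_nonneg.2 hl.2) hl.1 (by ring)
      convert this using 1; simp only [smul_eq_mul]; ring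
    · have a1 : x ∈ Ioo (x - ε) (x + ε) := ⟨by linarith [hy.1, hy.2], by linarith [hy.1, hy.2]⟩
      have := (convex_Ioo (x - ε) (x + ε)) a1 hy (sub_nonneg.2 hl.2) hl.1 (by ring)
      have e : γ j (t + l * (s - t)) = x + l * (y - x) := by linarith
      rw [e]
      convert this using 1; simp only [smul_eq_mul]; ring
  obtain ⟨σ, h1, h2⟩ := key i le_rfl
  obtain ⟨σ', h1', h2'⟩ := key (i + 1) (by omega)
  rcases le_total σ σ' with h | h
  · exact ⟨i, i + 1, by omega, σ, h1, σ', h1', h2, h2', h⟩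
  · exact ⟨i + 1, i, by omega, σ', h1', σ, h1, h2', h2, h⟩

theorem Pos_self {s a : ℝ} (h : 0 < v s a) : Pos v s a a := by
  intro x hx; rw [uIcc_self] at hx; rw [mem_singleton_iff.1 hx]; exact h

theorem CSeq.edge {γ : ℕ → ℝ → ℝ} {t1 t0 : ℝ} (S : Sol v vt vx vxx) (Q : CSeq v γ t1 t0) (h1 : 0 < t1)
    {t x δ ε e : ℝ} (hd1 : t1 ≤ t - δ) (hd0 : t + δ ≤ t0) (hh : Hit γ t x δ ε)
    (he : ∀ s ∈ Ioo (t - δ) (t + δ), 0 < v s e)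
    (hP : ∀ s ∈ Ioo (t - δ) (t + δ), ∀ y ∈ Ioo (x - ε) (x + ε), 0 < v s y → Pos v s y e) : False := by
  obtain ⟨i, j, hij, s, hs, s', hs', hi, hj, hss⟩ := hh
  have ms : s ∈ Icc t1 t0 := ⟨by linarith [hs.1], by linarith [hs.2]⟩
  have ms' : s' ∈ Icc t1 t0 := ⟨by linarith [hs'.1], by linarith [hs'.2]⟩
  have P1 := hP s hs _ hi (Q.pos i s ms)
  have P2 := hP s' hs' _ hj (Q.pos j s' ms')
  have P3 := S.prop (h1.trans_le ms.1) hss (α := γ i) (β := fun _ => e) (Q.c i) continuous_const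
    (fun t ht => Q.pos i t ⟨ms.1.trans ht.1, ht.2.trans ms'.2⟩)
    (fun t ht => he t ⟨hs.1.trans_le ht.1, ht.2.trans_lt hs'.2⟩) P1
  exact Q.clash S h1 hij ms' (P3.trans P2.symm)

theorem CSeq.top {γ : ℕ → ℝ → ℝ} {t1 t0 : ℝ} (S : Sol v vt vx vxx) (Q : CSeq v γ t1 t0) (h1 : 0 < t1)
    {t x δ ε : ℝ} (hd1 : t1 ≤ t - δ) (hd0 : t + δ ≤ t0) (hh : Hit γ t x δ ε)
    (hT : ∀ y ∈ Ioo (x - ε) (x + ε), 0 < v (t + δ) y)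
    (hP : ∀ y ∈ Ioo (x - ε) (x + ε), ∀ s ∈ Ioo (t - δ) (t + δ), 0 < v s y →
      ∀ τ ∈ Icc s (t + δ), 0 < v τ y) : False := by
  obtain ⟨i, j, hij, s, hs, s', hs', hi, hj, hss⟩ := hh
  have key : ∀ i, ∀ s ∈ Ioo (t - δ) (t + δ), γ i s ∈ Ioo (x - ε) (x + ε) →
      Pos v (t + δ) (γ i (t + δ)) (γ i s) := by
    intro i s hs hi
    have ms : s ∈ Icc t1 t0 := ⟨by linarith [hs.1], by linarith [hs.2]⟩
    have p := Q.pos i s ms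
    exact S.prop (h1.trans_le ms.1) hs.2.le (α := γ i) (β := fun _ => γ i s) (Q.c i) continuous_const
      (fun τ ht => Q.pos i τ ⟨ms.1.trans ht.1, ht.2.trans hd0⟩)
      (fun τ ht => hP _ hi s hs p τ ht) (Pos_self p)
  have P : Pos v (t + δ) (γ i s) (γ j s') := fun y hy => hT y ((convex_Ioo _ _).ordConnected.uIcc_subset hi hj hy)
  refine Q.clash S h1 hij (s := t + δ) ⟨by linarith [hs.1, hs.2], hd0⟩ ?_
  exact ((key i s hs hi).trans P).trans (key j s' hs' hj).symm

theorem CSeq.bot {γ : ℕ → ℝ → ℝ} {t1 t0 : ℝ} (S : Sol v vt vx vxx) (Q : CSeq v γ t1 t0) (h1 : 0 < t1)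
    {t x δ ε : ℝ} (hd1 : t1 ≤ t - δ) (hd0 : t + δ ≤ t0) (hh : Hit γ t x δ ε)
    (hT : ∀ y ∈ Ioo (x - ε) (x + ε), 0 < v (t - δ) y)
    (hP : ∀ y ∈ Ioo (x - ε) (x + ε), ∀ s ∈ Ioo (t - δ) (t + δ), 0 < v s y →
      ∀ τ ∈ Icc (t - δ) s, 0 < v τ y) : False := by
  obtain ⟨i, j, hij, s, hs, s', hs', hi, hj, hss⟩ := hh
  have ms : s ∈ Icc t1 t0 := ⟨by linarith [hs.1], by linarith [hs.2]⟩
  have ms' : s' ∈ Icc t1 t0 := ⟨by linarith [hs'.1], by linarith [hs'.2]⟩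
  have P : Pos v (t - δ) (γ i s) (γ j s') := fun y hy => hT y ((convex_Ioo _ _).ordConnected.uIcc_subset hi hj hy)
  have q1 := hP _ hi s hs (Q.pos i s ms)
  have q2 := hP _ hj s' hs' (Q.pos j s' ms')
  have P2 := S.prop (h1.trans_le hd1) hs.1.le (α := fun _ => γ i s) (β := fun _ => γ j s') continuous_const
    continuous_const (fun τ hτ => q1 τ hτ) (fun τ hτ => q2 τ ⟨hτ.1, hτ.2.trans hss⟩) P
  have P3 := S.prop (h1.trans_le ms.1) hss (α := γ i) (β := fun _ => γ j s') (Q.c i)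
    continuous_const (fun τ hτ => Q.pos i τ ⟨ms.1.trans hτ.1, hτ.2.trans ms'.2⟩)
      (fun τ hτ => q2 τ ⟨hs.1.le.trans hτ.1, hτ.2⟩) P2
  exact Q.clash S h1 hij ms' P3
end

end

section

section
variable {v vt vx vxx : ℝ → ℝ → ℝ}

theorem box_pos {w : ℝ → ℝ → ℝ}
    (h : ContinuousOn (fun p : ℝ × ℝ => w p.1 p.2) (Set.Ioi 0 ×ˢ Set.univ)) {t x : ℝ} (ht : 0 < t)
    (hw : 0 < w t x) : ∃ ρ > 0, ρ < t ∧ ∀ s ∈ Icc (t - ρ) (t + ρ), ∀ y ∈ Icc (x - ρ) (x + ρ), 0 < w s y := by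
  have : ContinuousAt (fun p : ℝ × ℝ => w p.1 p.2) (t, x) :=
    h.continuousAt (prod_mem_nhds (Ioi_mem_nhds ht) univ_mem)
  have ev : ∀ᶠ p : ℝ × ℝ in nhds (t, x), 0 < w p.1 p.2 := this.eventually_const_lt hw
  rw [Metric.eventually_nhds_iff] at ev
  obtain ⟨ε, hε, H⟩ := ev
  refine ⟨min (ε / 2) (t / 2), by positivity, (min_le_right _ _).trans_lt (by linarith), fun s hs y hy => ?_⟩
  have m := min_le_left (ε / 2) (t / 2)
  refine H (y := (s, y)) ?_
  rw [Prod.dist_eq, max_lt_iff, Real.dist_eq, Real.dist_eq, abs_lt, abs_lt]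
  exact ⟨⟨by linarith [hs.1], by linarith [hs.2]⟩, ⟨by linarith [hy.1], by linarith [hy.2]⟩⟩

theorem smono {f f' : ℝ → ℝ} {a b : ℝ} (hd : ∀ x ∈ Icc a b, HasDerivAt f (f' x) x)
    (hp : ∀ x ∈ Icc a b, 0 < f' x) : StrictMonoOn f (Icc a b) :=
  strictMonoOn_of_hasDerivWithinAt_pos (convex_Icc a b)
    (fun x hx => (hd x hx).continuousAt.continuousWithinAt)
    (fun x hx => (hd x (interior_subset hx)).hasDerivWithinAt) (fun x hx => hp x (interior_subset hx))

theorem santi {f f' : ℝ → ℝ} {a b : ℝ} (hd : ∀ x ∈ Icc a b, HasDerivAt f (f' x) x)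
    (hp : ∀ x ∈ Icc a b, 0 < - f' x) : StrictAntiOn f (Icc a b) :=
  strictAntiOn_of_hasDerivWithinAt_neg (convex_Icc a b)
    (fun x hx => (hd x hx).continuousAt.continuousWithinAt)
    (fun x hx => (hd x (interior_subset hx)).hasDerivWithinAt) 
    (fun x hx => by linarith [hp x (interior_subset hx)])

theorem CSeq.vanish {γ : ℕ → ℝ → ℝ} {t1 t0 : ℝ} (S : Sol v vt vx vxx) (Q : CSeq v γ t1 t0) (h1 : 0 < t1)
    {t x : ℝ} (ht : t ∈ Ioo t1 t0) (hx : ∀ i, x ≤ γ i t)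
    (hcl : ∀ δ > 0, ∀ ε > 0, ∃ s ∈ Ioo (t - δ) (t + δ), ∃ y ∈ Ioo (x - ε) (x + ε), ∃ i, γ i s < y) :
    v t x = 0 ∧ vx t x = 0 ∧ vt t x = 0 := by
  have tp : 0 < t := h1.trans ht.1
  obtain ⟨r, hr⟩ : ∃ r, r = min (t - t1) (t0 - t) := ⟨_, rfl⟩
  have r0 : 0 < r := hr ▸ lt_min (by linarith [ht.1]) (by linarith [ht.2])
  have r1 : r ≤ t - t1 := hr ▸ min_le_left _ _
  have r2 : r ≤ t0 - t := hr ▸ min_le_right _ _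
  have hit : ∀ δ > 0, δ ≤ r → ∀ ε > 0, Hit γ t x δ ε := fun δ hδ hδr ε hε =>
    Q.hit (by linarith) (by linarith) hx (hcl δ hδ ε hε)
  have v0 : v t x = 0 := by
    rcases lt_trichotomy (v t x) 0 with hv | hv | hv
    · exfalso
      obtain ⟨ρ, ρ0, ρt, hρ⟩ := box_pos (w := fun t x => - v t x) S.neg.cv tp (x := x) (by simpa using hv)
      obtain ⟨δ, hδ⟩ : ∃ δ, δ = min ρ r := ⟨_, rfl⟩
      have d0 : 0 < δ := hδ ▸ lt_min ρ0 r0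
      have d1 : δ ≤ ρ := hδ ▸ min_le_left _ _
      have d2 : δ ≤ r := hδ ▸ min_le_right _ _
      obtain ⟨i, j, hij, s, hs, s', hs', hi, hj, hss⟩ := hit δ d0 d2 ρ ρ0
      have a := hρ s ⟨by linarith [hs.1], by linarith [hs.2]⟩ _ (Ioo_subset_Icc_self hi)
      have b := Q.pos i s ⟨by linarith [hs.1], by linarith [hs.2]⟩
      linarith
    · exact hv
    · exfalso
      obtain ⟨ρ, ρ0, ρt, hρ⟩ := box_pos S.cv tp hv
      obtain ⟨δ, hδ⟩ : ∃ δ, δ = min ρ r := ⟨_, rfl⟩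
      have d0 : 0 < δ := hδ ▸ lt_min ρ0 r0
      have d1 : δ ≤ ρ := hδ ▸ min_le_left _ _
      have d2 : δ ≤ r := hδ ▸ min_le_right _ _
      have hb : ∀ s ∈ Ioo (t - δ) (t + δ), s ∈ Icc (t - ρ) (t + ρ) := fun s hs =>
        ⟨by linarith [hs.1], by linarith [hs.2]⟩
      have hxm : x ∈ Icc (x - ρ) (x + ρ) := ⟨by linarith, by linarith⟩
      refine Q.edge S h1 (e := x) (by linarith) (by linarith) (hit δ d0 d2 ρ ρ0) (fun s hs => hρ s (hb s hs) x hxm) ?_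
      intro s hs y hy _ z hz
      exact hρ s (hb s hs) z ((convex_Icc _ _).ordConnected.uIcc_subset (Ioo_subset_Icc_self hy) hxm hz)
  refine ⟨v0, ?_, ?_⟩
  · rcases lt_trichotomy (vx t x) 0 with hv | hv | hv
    · exfalso
      obtain ⟨ρ, ρ0, ρt, hρ⟩ := box_pos (w := fun t x => - vx t x) S.neg.cx tp (x := x) (by simpa using hv)
      have mono : ∀ s ∈ Icc (t - ρ) (t + ρ), StrictAntiOn (fun y => v s y) (Icc (x - ρ) (x + ρ)) := fun s hs =>
        santi (fun y hy => S.dx s (by linarith [hs.1]) y) (hρ s hs)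
      have hv1 : 0 < v t (x - ρ) := by
        rw [← v0]
        exact mono t ⟨by linarith, by linarith⟩ ⟨by linarith, by linarith⟩ ⟨by linarith, by linarith⟩ (by linarith)
      obtain ⟨ρ', ρ0', ρt', hρ'⟩ := box_pos S.cv tp hv1
      obtain ⟨δ, hδ⟩ : ∃ δ, δ = min (min ρ ρ') r := ⟨_, rfl⟩
      have d0 : 0 < δ := hδ ▸ lt_min (lt_min ρ0 ρ0') r0
      have d1 : δ ≤ ρ := hδ ▸ (min_le_left _ _).trans (min_le_left _ _)
      have d1' : δ ≤ ρ' := hδ ▸ (min_le_left _ _).trans (min_le_right _ _)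
      have d2 : δ ≤ r := hδ ▸ min_le_right _ _
      have he : ∀ s ∈ Ioo (t - δ) (t + δ), 0 < v s (x - ρ) := fun s hs =>
        hρ' s ⟨by linarith [hs.1], by linarith [hs.2]⟩ _ ⟨by linarith, by linarith⟩
      refine Q.edge S h1 (e := x - ρ) (by linarith) (by linarith) (hit δ d0 d2 ρ ρ0) he ?_
      intro s hs y hy hp z hz
      rw [uIcc_of_ge hy.1.le] at hz
      have := (mono s ⟨by linarith [hs.1], by linarith [hs.2]⟩).antitoneOn (a := z) (b := y)
        ⟨by linarith [hz.1], by linarith [hz.2, hy.2]⟩ (Ioo_subset_Icc_self hy) hz.2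
      exact lt_of_lt_of_le hp this
    · exact hv
    · exfalso
      obtain ⟨ρ, ρ0, ρt, hρ⟩ := box_pos S.cx tp (x := x) (by simpa using hv)
      have mono : ∀ s ∈ Icc (t - ρ) (t + ρ), StrictMonoOn (fun y => v s y) (Icc (x - ρ) (x + ρ)) := fun s hs =>
        smono (fun y hy => S.dx s (by linarith [hs.1]) y) (hρ s hs)
      have hv1 : 0 < v t (x + ρ) := by
        rw [← v0]
        exact mono t ⟨by linarith, by linarith⟩ ⟨by linarith, by linarith⟩ ⟨by linarith, by linarith⟩ (by linarith)
      obtain ⟨ρ', ρ0', ρt', hρ'⟩ := box_pos S.cv tp hv1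
      obtain ⟨δ, hδ⟩ : ∃ δ, δ = min (min ρ ρ') r := ⟨_, rfl⟩
      have d0 : 0 < δ := hδ ▸ lt_min (lt_min ρ0 ρ0') r0
      have d1 : δ ≤ ρ := hδ ▸ (min_le_left _ _).trans (min_le_left _ _)
      have d1' : δ ≤ ρ' := hδ ▸ (min_le_left _ _).trans (min_le_right _ _)
      have d2 : δ ≤ r := hδ ▸ min_le_right _ _
      have he : ∀ s ∈ Ioo (t - δ) (t + δ), 0 < v s (x + ρ) := fun s hs =>
        hρ' s ⟨by linarith [hs.1], by linarith [hs.2]⟩ _ ⟨by linarith, by linarith⟩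
      refine Q.edge S h1 (e := x + ρ) (by linarith) (by linarith) (hit δ d0 d2 ρ ρ0) he ?_
      intro s hs y hy hp z hz
      rw [uIcc_of_le hy.2.le] at hz
      have := (mono s ⟨by linarith [hs.1], by linarith [hs.2]⟩).monotoneOn (a := y) (b := z)
        (Ioo_subset_Icc_self hy) ⟨by linarith [hz.1, hy.1], by linarith [hz.2, hy.2]⟩ hz.1
      exact lt_of_lt_of_le hp this
  · rcases lt_trichotomy (vt t x) 0 with hv | hv | hv
    · exfalso
      obtain ⟨ρ, ρ0, ρt, hρ⟩ := box_pos (w := fun t x => - vt t x) S.neg.ct tp (x := x) (by simpa using hv)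
      have mono : ∀ y ∈ Icc (x - ρ) (x + ρ), StrictAntiOn (fun s => v s y) (Icc (t - ρ) (t + ρ)) := fun y hy =>
        santi (fun s hs => S.dt s (by linarith [hs.1]) y) (fun s hs => hρ s hs y hy)
      obtain ⟨δ, hδ⟩ : ∃ δ, δ = min ρ r := ⟨_, rfl⟩
      have d0 : 0 < δ := hδ ▸ lt_min ρ0 r0
      have d1 : δ ≤ ρ := hδ ▸ min_le_left _ _
      have d2 : δ ≤ r := hδ ▸ min_le_right _ _
      have hv1 : 0 < v (t - δ) x := by
        rw [← v0]
        exact mono x ⟨by linarith, by linarith⟩ ⟨by linarith, by linarith⟩ ⟨by linarith, by linarith⟩ (by linarith)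
      obtain ⟨ρ', ρ0', ρt', hρ'⟩ := box_pos S.cv (by linarith : 0 < t - δ) hv1
      obtain ⟨ε, hε⟩ : ∃ ε, ε = min ρ ρ' := ⟨_, rfl⟩
      have ε0 : 0 < ε := hε ▸ lt_min ρ0 ρ0'
      have e1 : ε ≤ ρ := hε ▸ min_le_left _ _
      have e2 : ε ≤ ρ' := hε ▸ min_le_right _ _
      refine Q.bot S h1 (by linarith) (by linarith) (hit δ d0 d2 ε ε0) ?_ ?_
      · intro y hy
        exact hρ' _ ⟨by linarith, by linarith⟩ y ⟨by linarith [hy.1], by linarith [hy.2]⟩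
      · intro y hy s hs hp τ hτ
        have := (mono y ⟨by linarith [hy.1], by linarith [hy.2]⟩).antitoneOn (a := τ) (b := s)
          ⟨by linarith [hτ.1], by linarith [hτ.2, hs.2]⟩ ⟨by linarith [hs.1], by linarith [hs.2]⟩ hτ.2
        exact lt_of_lt_of_le hp this
    · exact hv
    · exfalso
      obtain ⟨ρ, ρ0, ρt, hρ⟩ := box_pos S.ct tp (x := x) (by simpa using hv)
      have mono : ∀ y ∈ Icc (x - ρ) (x + ρ), StrictMonoOn (fun s => v s y) (Icc (t - ρ) (t + ρ)) := fun y hy =>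
        smono (fun s hs => S.dt s (by linarith [hs.1]) y) (fun s hs => hρ s hs y hy)
      obtain ⟨δ, hδ⟩ : ∃ δ, δ = min ρ r := ⟨_, rfl⟩
      have d0 : 0 < δ := hδ ▸ lt_min ρ0 r0
      have d1 : δ ≤ ρ := hδ ▸ min_le_left _ _
      have d2 : δ ≤ r := hδ ▸ min_le_right _ _
      have hv1 : 0 < v (t + δ) x := by
        rw [← v0]
        exact mono x ⟨by linarith, by linarith⟩ ⟨by linarith, by linarith⟩ ⟨by linarith, by linarith⟩ (by linarith)
      obtain ⟨ρ', ρ0', ρt', hρ'⟩ := box_pos S.cv (by linarith : 0 < t + δ) hv1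
      obtain ⟨ε, hε⟩ : ∃ ε, ε = min ρ ρ' := ⟨_, rfl⟩
      have ε0 : 0 < ε := hε ▸ lt_min ρ0 ρ0'
      have e1 : ε ≤ ρ := hε ▸ min_le_left _ _
      have e2 : ε ≤ ρ' := hε ▸ min_le_right _ _
      refine Q.top S h1 (by linarith) (by linarith) (hit δ d0 d2 ε ε0) ?_ ?_
      · intro y hy
        exact hρ' _ ⟨by linarith, by linarith⟩ y ⟨by linarith [hy.1], by linarith [hy.2]⟩
      · intro y hy s hs hp τ hτ
        have := (mono y ⟨by linarith [hy.1], by linarith [hy.2]⟩).monotoneOn (a := s) (b := τ)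
          ⟨by linarith [hs.1], by linarith [hs.2]⟩ ⟨by linarith [hτ.1, hs.1], by linarith [hτ.2, hs.2]⟩  hτ.1
        exact lt_of_lt_of_le hp this

/-! truncation -/
open Classical in
noncomputable def cut (γ : ℕ → ℝ → ℝ) (w : ℝ → ℝ → ℝ) (t x : ℝ) : ℝ := if ∃ i, γ i t < x then w t x else 0

theorem cut_le (γ : ℕ → ℝ → ℝ) (w : ℝ → ℝ → ℝ) (t x : ℝ) : |cut γ w t x| ≤ |w t x| := by
  unfold cut; split_ifs <;> simp

theorem cut_in {γ : ℕ → ℝ → ℝ} {t x : ℝ} (h : ∃ i, γ i t < x) (w : ℝ → ℝ → ℝ) : cut γ w t x = w t x := by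
  unfold cut; rw [if_pos h]

theorem cut_out {γ : ℕ → ℝ → ℝ} {t x : ℝ} (h : ¬ ∃ i, γ i t < x) (w : ℝ → ℝ → ℝ) : cut γ w t x = 0 := by
  unfold cut; rw [if_neg h]

theorem CSeq.tri {γ : ℕ → ℝ → ℝ} {t1 t0 : ℝ} (S : Sol v vt vx vxx) (Q : CSeq v γ t1 t0) (h1 : 0 < t1)
    {t x : ℝ} (ht : t ∈ Ioo t1 t0) :
    (∀ᶠ p : ℝ × ℝ in nhds (t, x), ∃ i, γ i p.1 < p.2) ∨ 
    (∀ᶠ p : ℝ × ℝ in nhds (t, x), ¬ ∃ i, γ i p.1 < p.2) ∨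
    ((¬ ∃ i, γ i t < x) ∧ v t x = 0 ∧ vx t x = 0 ∧ vt t x = 0 ∧ vxx t x = 0) := by
  by_cases hin : ∃ i, γ i t < x
  · left
    obtain ⟨i, hi⟩ := hin
    have hc := Q.c i
    have : IsOpen {p : ℝ × ℝ | γ i p.1 < p.2} := isOpen_lt (by fun_prop) (by fun_prop)
    filter_upwards [this.mem_nhds (show (t, x) ∈ {p : ℝ × ℝ | γ i p.1 < p.2} from hi)] with p hp
    exact ⟨i, hp⟩
  · right
    by_cases hev : ∀ᶠ p : ℝ × ℝ in nhds (t, x), ¬ ∃ i, γ i p.1 < p.2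
    · exact Or.inl hev
    · right
      have hx : ∀ i, x ≤ γ i t := by push Not at hin; exact hin
      obtain ⟨a, b, c⟩ := Q.vanish S h1 ht hx (by
        intro δ hδ ε hε
        rw [not_eventually] at hev
        have hm : Ioo (t - δ) (t + δ) ×ˢ Ioo (x - ε) (x + ε) ∈ nhds (t, x) :=
          prod_mem_nhds (Ioo_mem_nhds (by linarith) (by linarith)) (Ioo_mem_nhds (by linarith) (by linarith))
        obtain ⟨p, hp, hp'⟩ := (hev.and_eventually hm).exists
        rw [not_not] at hp
        exact ⟨p.1, hp'.1, p.2, hp'.2, hp⟩)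
      refine ⟨hin, a, b, c, ?_⟩
      obtain ⟨C, hC⟩ := S.ineq t1 h1
      have := hC t ht.1.le x
      rw [a, b, c] at this
      simpa using this

theorem hd_cut {f g : ℝ → ℝ} {a : ℝ} (h : HasDerivAt f 0 a) (h0 : f a = 0) (hg : ∀ y, |g y| ≤ |f y|) :
    HasDerivAt g 0 a := by
  have g0 : g a = 0 := by have := hg a; rw [h0] at this; simpa using this
  rw [hasDerivAt_iff_isLittleO] at h ⊢
  simp only [h0, g0, sub_zero, smul_zero] at h ⊢
  exact (Asymptotics.IsBigO.of_bound 1 (Eventually.of_forall fun y => by simpa using hg y)).trans_isLittleO h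

theorem cut_cont {γ : ℕ → ℝ → ℝ} {w : ℝ → ℝ → ℝ} {t x : ℝ}
    (hw : ContinuousOn (fun p : ℝ × ℝ => w p.1 p.2) (Set.Ioi 0 ×ˢ Set.univ)) (ht : 0 < t)
    (h : (∀ᶠ p : ℝ × ℝ in nhds (t, x), ∃ i, γ i p.1 < p.2) ∨ 
      (∀ᶠ p : ℝ × ℝ in nhds (t, x), ¬ ∃ i, γ i p.1 < p.2) ∨ w t x = 0) :
    ContinuousAt (fun p : ℝ × ℝ => cut γ w p.1 p.2) (t, x) := by
  have hc : ContinuousAt (fun p : ℝ × ℝ => w p.1 p.2) (t, x) :=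
    hw.continuousAt (prod_mem_nhds (Ioi_mem_nhds ht) univ_mem)
  rcases h with h | h | h
  · refine hc.congr ?_
    filter_upwards [h] with p hp
    rw [cut_in hp]
  · refine continuousAt_const (y := (0:ℝ)) |>.congr ?_
    filter_upwards [h] with p hp
    rw [cut_out hp]
  · have z : cut γ w t x = 0 := by have := cut_le γ w t x; rw [h] at this; simpa using this
    unfold ContinuousAt at hc ⊢
    simp only [h, z] at hc ⊢
    exact squeeze_zero_norm (fun p => cut_le γ w p.1 p.2) (by simpa using hc.norm)

theorem CSeq.false {γ : ℕ → ℝ → ℝ} {t1 t0 : ℝ} (S : Sol v vt vx vxx) (Q : CSeq v γ t1 t0) (h1 : 0 < t1)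
    (h10 : t1 < t0) : False := by
  obtain ⟨C, C0, hC⟩ := S.ineq' h1
  obtain ⟨B, hB⟩ := S.bound (q := t0) h1
  have pos : ∀ t ∈ Ioo t1 t0, 0 < t := fun t ht => h1.trans ht.1
  have mem : ∀ t ∈ Ioo t1 t0, t ∈ Icc t1 t0 := fun t ht => Ioo_subset_Icc_self ht
  have sx : ∀ t x : ℝ, ContinuousAt (fun y : ℝ => (t, y)) x := fun t x => by fun_prop
  have st : ∀ t x : ℝ, ContinuousAt (fun s : ℝ => (s, x)) t := fun t x => by fun_prop
  have cc : ∀ {w : ℝ → ℝ → ℝ}, ContinuousOn (fun p : ℝ × ℝ => w p.1 p.2) (Set.Ioi 0 ×ˢ Set.univ) →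
      (∀ t x, v t x = 0 ∧ vx t x = 0 ∧ vt t x = 0 ∧ vxx t x = 0 → w t x = 0) → 
      ∀ t ∈ Ioo t1 t0, ∀ x, ContinuousAt (fun p : ℝ × ℝ => cut γ w p.1 p.2) (t, x) := by
    intro w hw h0 t ht x
    apply cut_cont hw (pos t ht)
    rcases Q.tri S h1 ht (x := x) with h | h | h
    · exact Or.inl h
    · exact Or.inr (Or.inl h)
    · exact Or.inr (Or.inr (h0 t x h.2))
  have L : Loc (cut γ v) (cut γ vt) (cut γ vx) (cut γ vxx) t1 t0 C B := by
    refine ⟨?_, ?_, ?_, ?_, ?_, ?_, ?_, ?_, ?_, ?_, ?_, C0, ?_, ?_⟩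
    · intro t ht
      refine continuous_iff_continuousAt.2 fun x => ?_
      exact ContinuousAt.comp (g := fun p : ℝ × ℝ => cut γ vt p.1 p.2) (f := fun y : ℝ => (t, y))
        (cc S.ct (fun _ _ h => h.2.2.1) t ht x) (sx t x)
    · intro t ht
      refine continuous_iff_continuousAt.2 fun x => ?_
      exact ContinuousAt.comp (g := fun p : ℝ × ℝ => cut γ vxx p.1 p.2) (f := fun y : ℝ => (t, y))
        (cc S.cxx (fun _ _ h => h.2.2.2) t ht x) (sx t x)
    · intro t ht x
      exact ContinuousAt.comp (g := fun p : ℝ × ℝ => cut γ vx p.1 p.2) (f := fun s : ℝ => (s, x))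
        (cc S.cx (fun _ _ h => h.2.1) t ht x) (st t x)
    · intro t ht x
      exact ContinuousAt.comp (g := fun p : ℝ × ℝ => cut γ vxx p.1 p.2) (f := fun s : ℝ => (s, x))
        (cc S.cxx (fun _ _ h => h.2.2.2) t ht x) (st t x)
    · intro t ht x
      rcases Q.tri S h1 ht (x := x) with h | h | h
      · rw [cut_in h.self_of_nhds]
        refine (S.dt t (pos t ht) x).congr_of_eventuallyEq ?_
        filter_upwards [(st t x).eventually h] with s hs using cut_in hs v
      · rw [cut_out h.self_of_nhds]
        refine (hasDerivAt_const t (0:ℝ)).congr_of_eventuallyEq ?_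
        filter_upwards [(st t x).eventually h] with s hs using cut_out hs v
      · rw [cut_out h.1]
        have := S.dt t (pos t ht) x
        rw [h.2.2.2.1] at this
        exact hd_cut this h.2.1 (fun s => cut_le γ v s x)
    · intro t ht x
      rcases Q.tri S h1 ht (x := x) with h | h | h
      · rw [cut_in h.self_of_nhds]
        refine (S.dx t (pos t ht) x).congr_of_eventuallyEq ?_
        filter_upwards [(sx t x).eventually h] with s hs using cut_in hs v
      · rw [cut_out h.self_of_nhds]
        refine (hasDerivAt_const x (0:ℝ)).congr_of_eventuallyEq ?_
        filter_upwards [(sx t x).eventually h] with s hs using cut_out hs v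
      · rw [cut_out h.1]
        have := S.dx t (pos t ht) x
        rw [h.2.2.1] at this
        exact hd_cut this h.2.1 (fun s => cut_le γ v t s)
    · intro t ht x
      rcases Q.tri S h1 ht (x := x) with h | h | h
      · rw [cut_in h.self_of_nhds]
        refine (S.dxx t (pos t ht) x).congr_of_eventuallyEq ?_
        filter_upwards [(sx t x).eventually h] with s hs using cut_in hs vx
      · rw [cut_out h.self_of_nhds]
        refine (hasDerivAt_const x (0:ℝ)).congr_of_eventuallyEq ?_
        filter_upwards [(sx t x).eventually h] with s hs using cut_out hs vx
      · rw [cut_out h.1]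
        have := S.dxx t (pos t ht) x
        rw [h.2.2.2.2] at this
        exact hd_cut this h.2.2.1 (fun s => cut_le γ vx t s)
    · exact fun t ht x => (cut_le _ _ _ _).trans (hB t (mem t ht) x).1
    · exact fun t ht x => (cut_le _ _ _ _).trans (hB t (mem t ht) x).2.1
    · exact fun t ht x => (cut_le _ _ _ _).trans (hB t (mem t ht) x).2.2.1
    · exact fun t ht x => (cut_le _ _ _ _).trans (hB t (mem t ht) x).2.2.2
    · intro t ht x
      by_cases h : ∃ i, γ i t < x
      · simp only [cut_in h]; exact hC t ht.1.le x
      · simp [cut_out h]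
    · intro t ht
      obtain ⟨x, hx⟩ := S.nz t (pos t ht)
      obtain ⟨n, hn⟩ := exists_nat_gt ((γ 0 t - x) / (2 * π))
      refine ⟨x + (n : ℤ) * (2 * π), ?_⟩
      rw [cut_in ⟨0, ?_⟩, S.per_int (pos t ht)]
      · exact hx
      · rw [div_lt_iff₀ (by positivity)] at hn
        push_cast; linarith
  have hm : (t1 + t0) / 2 ∈ Ioo t1 t0 := ⟨by linarith, by linarith⟩
  refine L.ucp (tb := (t1 + t0) / 2) (x0 := γ 0 ((t1 + t0) / 2) - 2 * π - 1) (r := 1) hm one_pos ?_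
  intro x hx
  rw [abs_lt] at hx
  apply cut_out
  rintro ⟨i, hi⟩
  have := Q.low _ (mem _ hm) i
  linarith [hx.2]
end

end

section

section
variable {v vt vx vxx : ℝ → ℝ → ℝ}

theorem lt_of_noMeet {α β : ℝ → ℝ} {t1 t0 : ℝ} (hα : Continuous α) (hβ : Continuous β)
    (hne : ∀ s ∈ Icc t1 t0, α s ≠ β s) (h0 : α t0 < β t0) : ∀ s ∈ Icc t1 t0, α s < β s := by
  intro s hs
  by_contra hc
  push Not at hc
  have : (0:ℝ) ∈ (fun r => β r - α r) '' Icc s t0 :=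
    intermediate_value_Icc hs.2 (by fun_prop) ⟨by simpa using hc, by simpa using h0.le⟩
  obtain ⟨r, hr, h⟩ := this
  exact hne r ⟨hs.1.trans hr.1, hr.2⟩ (by simp only at h; linarith)

theorem adj_pos (S : Sol v vt vx vxx) {α β : ℝ → ℝ} {t1 t0 z : ℝ} (h1 : 0 < t1)
    (hα : Continuous α) (hβ : Continuous β) (pα : ∀ s ∈ Icc t1 t0, 0 < v s (α s))
    (pβ : ∀ s ∈ Icc t1 t0, 0 < v s (β s)) (z1 : α t0 < z) (z2 : z < β t0) (hz : v t0 z = 0) :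
    ∀ s ∈ Icc t1 t0, α s < β s ∧ ∃ y ∈ Ioo (α s) (β s), v s y = 0 := by
  have np : ∀ s ∈ Icc t1 t0, ¬ Pos v s (α s) (β s) := by
    intro s hs hp
    have := S.prop (h1.trans_le hs.1) hs.2 hα hβ (fun t ht => pα t ⟨hs.1.trans ht.1, ht.2⟩)
      (fun t ht => pβ t ⟨hs.1.trans ht.1, ht.2⟩) hp z
      (by rw [uIcc_of_le (z1.trans z2).le]; exact ⟨z1.le, z2.le⟩)
    linarith
  have ord := lt_of_noMeet hα hβ (fun s hs h => np s hs (by rw [← h]; exact Pos_self (pα s hs))) (z1.trans z2)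
  intro s hs
  refine ⟨ord s hs, ?_⟩
  have := np s hs
  unfold Pos at this
  push Not at this
  obtain ⟨x, hx, hvx⟩ := this
  rw [uIcc_of_le (ord s hs).le] at hx
  have sp : 0 < s := h1.trans_le hs.1
  have hc : Continuous (fun y => v s y) := cont_slice_x S.cv sp
  obtain ⟨y, hy, hy0⟩ : (0:ℝ) ∈ (fun y => v s y) '' Icc (α s) x :=
    intermediate_value_Icc' hx.1 hc.continuousOn ⟨hvx, (pα s hs).le⟩
  simp only at hy0
  refine ⟨y, ⟨lt_of_le_of_ne hy.1 ?_, lt_of_le_of_ne (hy.2.trans hx.2) ?_⟩, hy0⟩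
  · intro h; have := pα s hs; rw [h] at this; linarith
  · intro h; have := pβ s hs; rw [← h] at this; linarith

theorem adj_mix (S : Sol v vt vx vxx) {α β : ℝ → ℝ} {t1 t0 : ℝ} (h1 : 0 < t1)
    (hα : Continuous α) (hβ : Continuous β) (pα : ∀ s ∈ Icc t1 t0, 0 < v s (α s))
    (pβ : ∀ s ∈ Icc t1 t0, v s (β s) < 0) (h0 : α t0 < β t0) :
    ∀ s ∈ Icc t1 t0, α s < β s ∧ ∃ y ∈ Ioo (α s) (β s), v s y = 0 := by
  have ord := lt_of_noMeet hα hβ (fun s hs h => by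
    have a := pα s hs; have b := pβ s hs; rw [h] at a; linarith) h0
  intro s hs
  refine ⟨ord s hs, ?_⟩
  have sp : 0 < s := h1.trans_le hs.1
  have hc : Continuous (fun y => v s y) := cont_slice_x S.cv sp
  obtain ⟨y, hy, hy0⟩ : (0:ℝ) ∈ (fun y => v s y) '' Ioo (α s) (β s) :=
    intermediate_value_Ioo' (ord s hs).le hc.continuousOn ⟨pβ s hs, pα s hs⟩
  exact ⟨y, hy, hy0⟩

/-- sign-definite curve -/
def SC (v : ℝ → ℝ → ℝ) (α : ℝ → ℝ) (t1 t0 : ℝ) : Prop :=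
  (∀ s ∈ Icc t1 t0, 0 < v s (α s)) ∨ (∀ s ∈ Icc t1 t0, v s (α s) < 0)

theorem adj (S : Sol v vt vx vxx) {α β : ℝ → ℝ} {t1 t0 z : ℝ} (h1 : 0 < t1)
    (hα : Continuous α) (hβ : Continuous β) (pα : SC v α t1 t0)
    (pβ : SC v β t1 t0) (z1 : α t0 < z) (z2 : z < β t0) (hz : v t0 z = 0) :
    ∀ s ∈ Icc t1 t0, α s < β s ∧ ∃ y ∈ Ioo (α s) (β s), v s y = 0 := by
  rcases pα with pα | pα <;> rcases pβ with pβ | pβ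
  · exact adj_pos S h1 hα hβ pα pβ z1 z2 hz
  · exact adj_mix S h1 hα hβ pα pβ (z1.trans z2)
  · have := adj_mix S.neg h1 hα hβ (fun s hs => by simpa using pα s hs) (fun s hs => by simpa using pβ s hs) (z1.trans z2)
    simpa using this
  · have := adj_pos S.neg h1 hα hβ (fun s hs => by simpa using pα s hs) (fun s hs => by simpa using pβ s hs) z1 z2 (by simpa using hz)
    simpa using this

theorem Sol.npath (S : Sol v vt vx vxx) {t1 t0 p : ℝ} (h1 : 0 < t1) (h10 : t1 ≤ t0) (hp : v t0 p ≠ 0) :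
    ∃ γ : ℝ → ℝ, Continuous γ ∧ γ t0 = p ∧ SC v γ t1 t0 := by
  rcases lt_or_gt_of_ne hp with h | h
  · obtain ⟨γ, a, b, c⟩ := S.neg.path h1 h10 (p := p) (by simpa using h)
    exact ⟨γ, a, b, Or.inr fun s hs => by simpa using c s hs⟩
  · obtain ⟨γ, a, b, c⟩ := S.path h1 h10 h
    exact ⟨γ, a, b, Or.inl c⟩

theorem Sol.fin_aux (S : Sol v vt vx vxx) {t0 : ℝ} (ht : 0 < t0) {z p : ℕ → ℝ} (hz : StrictAnti z)
    (h2 : ∀ n, z 0 - z n < 2 * π) (hz0 : ∀ n, v t0 (z n) = 0) (hp : ∀ n, p n ∈ Ioo (z (n+1)) (z n))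
    (hf : ∃ᶠ n in atTop, 0 < v t0 (p n)) : False := by
  obtain ⟨φ, hφ, hpos⟩ := extraction_of_frequently_atTop hf
  have h1 : 0 < t0 / 2 := by linarith
  have h10 : t0 / 2 < t0 := by linarith
  choose γ c1 c2 c3 using fun i => S.path h1 h10.le (hpos i)
  have t0m : t0 ∈ Icc (t0 / 2) t0 := ⟨h10.le, le_rfl⟩
  have hlt : ∀ i j, i < j → p (φ j) < z (φ i + 1) := fun i j hij =>
    (hp (φ j)).2.trans_le (hz.antitone (hφ hij))
  have key : ∀ i j, i < j → ∀ s ∈ Icc (t0 / 2) t0, γ j s < γ i s ∧ ∃ y ∈ Ioo (γ j s) (γ i s), v s y = 0 :=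
    fun i j hij => adj_pos S h1 (c1 j) (c1 i) (c3 j) (c3 i) (z := z (φ i + 1))
      (by rw [c2]; exact hlt i j hij) (by rw [c2]; exact (hp (φ i)).1) (hz0 _)
  have np : ∀ i j, i < j → ¬ Pos v t0 (γ i t0) (γ j t0) := by
    intro i j hij hP
    obtain ⟨a, y, hy, h⟩ := key i j hij t0 t0m
    have := hP y (by rw [uIcc_of_ge a.le]; exact Ioo_subset_Icc_self hy)
    linarith
  refine CSeq.false (γ := γ) S ⟨c1, c3, fun s hs i j hij => (key i j hij s hs).1, ?_, ?_⟩ h1 h10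
  · intro s hs i
    have := adj_pos S h1 (α := fun s => γ 0 s - 2 * π) (β := γ i) (t1 := t0 / 2) (t0 := t0) (z := z (φ i + 1)) ((c1 0).sub continuous_const) (c1 i) ?_ (c3 i) ?_ (by rw [c2]; exact (hp (φ i)).1) (hz0 _) s hs
    · exact this.1
    · intro s hs
      have := S.per s (h1.trans_le hs.1) (γ 0 s - 2 * π)
      rw [sub_add_cancel] at this
      rw [← this]; exact c3 0 s hs
    · rw [c2]
      have a := (hp (φ 0)).2
      have b := hz.antitone (Nat.zero_le (φ 0))
      have c := h2 (φ i + 1)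
      linarith
  · intro i j hij
    rcases lt_or_gt_of_ne hij with h | h
    · exact np i j h
    · exact fun hP => np j i h hP.symm

theorem Sol.fin_anti (S : Sol v vt vx vxx) {t0 : ℝ} (ht : 0 < t0) {z : ℕ → ℝ} (hz : StrictAnti z)
    (h2 : ∀ n, z 0 - z n < 2 * π) (hz0 : ∀ n, v t0 (z n) = 0) : False := by
  choose p hp hpn using fun n => S.no_int ht (hz (Nat.lt_succ_self n))
  have : ∃ᶠ n in atTop, (0 < v t0 (p n) ∨ v t0 (p n) < 0) := by
    refine Eventually.frequently (Eventually.of_forall fun n => ?_)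
    rcases lt_or_gt_of_ne (hpn n) with h | h
    · exact Or.inr h
    · exact Or.inl h
  rw [frequently_or_distrib] at this
  rcases this with h | h
  · exact S.fin_aux ht hz h2 hz0 hp h
  · exact S.neg.fin_aux ht hz h2 (by simpa using hz0) hp (by simpa using h)

theorem Sol.finite (S : Sol v vt vx vxx) {t0 : ℝ} (ht : 0 < t0) :
    {x ∈ Set.Ico (0 : ℝ) (2 * Real.pi) | v t0 x = 0}.Finite := by
  by_contra hinf
  have hinf : {x ∈ Set.Ico (0 : ℝ) (2 * Real.pi) | v t0 x = 0}.Infinite := hinf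
  obtain ⟨f, hf⟩ : ∃ f : ℕ → ℝ, Function.Injective f ∧ ∀ n, f n ∈ {x ∈ Set.Ico (0 : ℝ) (2 * Real.pi) | v t0 x = 0} :=
    ⟨fun n => hinf.natEmbedding _ n, fun a b h => (hinf.natEmbedding _).injective (Subtype.ext h),
      fun n => (hinf.natEmbedding _ n).2⟩
  obtain ⟨g, hg⟩ := exists_increasing_or_nonincreasing_subseq (· > ·) f
  rcases hg with hg | hg
  · refine S.fin_anti ht (z := f ∘ g) (fun m n h => hg m n h) (fun n => ?_) (fun n => (hf.2 _).2)
    have a := (hf.2 (g 0)).1.2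
    have b := (hf.2 (g n)).1.1
    simp only [Function.comp]; linarith
  · refine S.reflect.fin_anti ht (z := fun n => - f (g n)) (fun m n h => ?_) (fun n => ?_) (fun n => ?_)
    · have a := hg m n h
      have b : f (g m) ≠ f (g n) := fun e => h.ne (g.injective (hf.1 e))
      simp only [gt_iff_lt, not_lt] at a
      exact neg_lt_neg (lt_of_le_of_ne a b)
    · have a := (hf.2 (g n)).1.2
      have b := (hf.2 (g 0)).1.1
      linarith
    · simpa using (hf.2 (g n)).2
end

end

section

section
variable {v vt vx vxx : ℝ → ℝ → ℝ}

theorem Sol.mono (S : Sol v vt vx vxx) {t1 t2 : ℝ} (h1 : 0 < t1) (h12 : t1 ≤ t2) :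
    {x ∈ Set.Ico (0 : ℝ) (2 * Real.pi) | v t2 x = 0}.encard ≤
    {x ∈ Set.Ico (0 : ℝ) (2 * Real.pi) | v t1 x = 0}.encard := by
  have h2 : 0 < t2 := h1.trans_le h12
  have hfin := S.finite h2
  obtain ⟨F, hF⟩ : ∃ F : Finset ℝ, (F : Set ℝ) = {x ∈ Set.Ico (0 : ℝ) (2 * Real.pi) | v t2 x = 0} :=
    ⟨hfin.toFinset, hfin.coe_toFinset⟩
  rw [← hF, Set.encard_coe_eq_coe_finsetCard]
  obtain ⟨n, hn⟩ : ∃ n, F.card = n := ⟨_, rfl⟩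
  rw [hn]
  rcases Nat.eq_zero_or_pos n with h0 | hpos
  · rw [h0]; simp
  let e := F.orderEmbOfFin hn
  have he : ∀ i, e i ∈ Set.Ico (0 : ℝ) (2 * Real.pi) ∧ v t2 (e i) = 0 := by
    intro i
    have : e i ∈ (F : Set ℝ) := F.orderEmbOfFin_mem hn i
    rw [hF] at this
    exact this
  let X : ℕ → ℝ := fun k => if h : k < n then e ⟨k, h⟩ else e ⟨0, hpos⟩ + 2 * π + (k - n)
  have X1 : ∀ k (h : k < n), X k = e ⟨k, h⟩ := fun k h => dif_pos h
  have X2 : ∀ k, ¬ k < n → X k = e ⟨0, hpos⟩ + 2 * π + (k - n) := fun k h => dif_neg h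
  have hX : ∀ k, X k < X (k + 1) := by
    intro k
    by_cases hk1 : k + 1 < n
    · rw [X1 k (by omega), X1 _ hk1]
      exact e.strictMono (by simp [Fin.lt_def])
    · rw [X2 _ hk1]
      by_cases hk : k < n
      · have : k + 1 = n := by omega
        rw [X1 k hk, this]
        have a := (he ⟨k, hk⟩).1.2
        have b := (he ⟨0, hpos⟩).1.1
        linarith
      · rw [X2 k hk]; push_cast; linarith
  have Xn : X n = X 0 + 2 * π := by rw [X2 n (by omega), X1 0 hpos]; ring
  have Xz : ∀ k ≤ n, v t2 (X k) = 0 := by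
    intro k hk
    rcases hk.lt_or_eq with h | h
    · rw [X1 k h]; exact (he _).2
    · rw [h, Xn, S.per t2 h2, X1 0 hpos]; exact (he _).2
  choose p hp hpn using fun k => S.no_int h2 (hX k)
  choose γ c1 c2 c3 using fun k => S.npath h1 h12 (hpn k)
  let Γ : ℕ → ℝ → ℝ := fun k => if k < n then γ k else fun s => γ 0 s + 2 * π
  have Γ1 : ∀ k, k < n → Γ k = γ k := fun k h => if_pos h
  have Γ2 : ∀ k, ¬ k < n → Γ k = fun s => γ 0 s + 2 * π := fun k h => if_neg h
  have Γc : ∀ k, Continuous (Γ k) := by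
    intro k
    by_cases h : k < n
    · rw [Γ1 k h]; exact c1 k
    · rw [Γ2 k h]; exact (c1 0).add continuous_const
  have Γs : ∀ k, SC v (Γ k) t1 t2 := by
    intro k
    by_cases h : k < n
    · rw [Γ1 k h]; exact c3 k
    · rw [Γ2 k h]
      rcases c3 0 with c | c
      · exact Or.inl fun s hs => by simpa only [S.per s (h1.trans_le hs.1)] using c s hs
      · exact Or.inr fun s hs => by simpa only [S.per s (h1.trans_le hs.1)] using c s hs
  have key : ∀ k, k < n → Γ k t1 < Γ (k + 1) t1 ∧ ∃ y ∈ Ioo (Γ k t1) (Γ (k + 1) t1), v t1 y = 0 := by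
    intro k hk
    refine adj S h1 (Γc k) (Γc (k + 1)) (Γs k) (Γs (k + 1)) (z := X (k + 1)) ?_ ?_ (Xz _ hk) t1 ⟨le_rfl, h12⟩
    · rw [Γ1 k hk, c2]; exact (hp k).2
    · by_cases h : k + 1 < n
      · rw [Γ1 _ h, c2]; exact (hp _).1
      · have : k + 1 = n := by omega
        rw [Γ2 _ h, this, Xn]
        simp only [c2]
        linarith [(hp 0).1]
  have Γm : ∀ i j, i ≤ j → j ≤ n → Γ i t1 ≤ Γ j t1 := by
    intro i j hij
    induction j, hij using Nat.le_induction with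
    | base => intro _; exact le_rfl
    | succ j _ ih => intro h; exact (ih (by omega)).trans (key j (by omega)).1.le
  choose y hy hy0 using fun k : Fin n => (key k k.2).2
  have ylt : ∀ i j : Fin n, i < j → y i < y j := fun i j hij =>
    (hy i).2.trans_le ((Γm (i + 1) j hij j.2.le).trans (hy j).1.le)
  have G0 : Γ 0 t1 = γ 0 t1 := by rw [Γ1 0 hpos]
  have Gn : Γ n t1 = γ 0 t1 + 2 * π := by rw [Γ2 n (by omega)]
  have yb : ∀ i : Fin n, γ 0 t1 < y i ∧ y i < γ 0 t1 + 2 * π := fun i =>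
    ⟨G0 ▸ (Γm 0 i (Nat.zero_le _) i.2.le).trans_lt (hy i).1,
      Gn ▸ (hy i).2.trans_le (Γm (i + 1) n i.2 le_rfl)⟩
  have yinj : Function.Injective (fun i => toIcoMod two_pi_pos 0 (y i)) := by
    intro i j hij
    simp only [toIcoMod] at hij
    obtain ⟨m, hm⟩ : ∃ m : ℤ, y i - y j = m * (2 * π) :=
      ⟨toIcoDiv two_pi_pos 0 (y i) - toIcoDiv two_pi_pos 0 (y j), by
        simp only [zsmul_eq_mul] at hij; push_cast; linarith⟩
    have a := yb i
    have b := yb j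
    have pp := two_pi_pos
    have m1 : (m : ℝ) < 1 := by nlinarith
    have m2 : (-1 : ℝ) < m := by nlinarith
    have m1' : m < 1 := by exact_mod_cast m1
    have m2' : -1 < m := by exact_mod_cast m2
    have m0 : m = 0 := by omega
    rw [m0] at hm
    rcases lt_trichotomy i j with h | h | h
    · have := ylt i j h; simp at hm; linarith
    · exact h
    · have := ylt j i h; simp at hm; linarith
  have : (n : ℕ∞) = ((fun i => toIcoMod two_pi_pos 0 (y i)) '' univ).encard := by
    rw [yinj.encard_image, Set.encard_univ]; simp
  rw [this]
  refine Set.encard_le_encard ?_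
  rintro _ ⟨i, _, rfl⟩
  refine ⟨?_, ?_⟩
  · have := toIcoMod_mem_Ico two_pi_pos 0 (y i)
    simpa using this
  · have := S.per_int h1 (y i) (- toIcoDiv two_pi_pos 0 (y i))
    refine Eq.trans ?_ (this.trans (hy0 i))
    congr 1
    simp only [toIcoMod, zsmul_eq_mul]; push_cast; ring
end

end

theorem lip_aux {f f' : ℝ → ℝ} {M A : ℝ} (hd : ∀ x, HasDerivAt f (f' x) x)
    (hb : ∀ x ∈ Icc (-M) M, |f' x| ≤ A) {a b : ℝ} (ha : |a| ≤ M) (hb' : |b| ≤ M) :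
    |f a - f b| ≤ A * |a - b| := by
  have := (convex_Icc (-M) M).norm_image_sub_le_of_norm_hasDerivWithin_le (f := f) (f' := f') (C := A)
    (fun x _ => (hd x).hasDerivWithinAt) (fun x hx => by simpa using hb x hx)
    (x := b) (y := a) (abs_le.1 hb') (abs_le.1 ha)
  simpa using this

theorem stmt4
    (g gu gp guu gup gpu gpp : ℝ → ℝ → ℝ → ℝ)
    (hg_cont : Continuous (fun p : ℝ × ℝ × ℝ => g p.1 p.2.1 p.2.2))
    (hgC2 : ∀ t : ℝ, ContDiff ℝ 2 (fun q : ℝ × ℝ => g t q.1 q.2))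
    (hgu : ∀ t u p : ℝ, HasDerivAt (fun v => g t v p) (gu t u p) u)
    (hgp : ∀ t u p : ℝ, HasDerivAt (fun q => g t u q) (gp t u p) p)
    (hguu : ∀ t u p : ℝ, HasDerivAt (fun v => gu t v p) (guu t u p) u)
    (hgup : ∀ t u p : ℝ, HasDerivAt (fun q => gu t u q) (gup t u p) p)
    (hgpu : ∀ t u p : ℝ, HasDerivAt (fun v => gp t v p) (gpu t u p) u)
    (hgpp : ∀ t u p : ℝ, HasDerivAt (fun q => gp t u q) (gpp t u p) p)
    (hadm : Admissible g ∧ Admissible gu ∧ Admissible gp ∧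
      Admissible guu ∧ Admissible gup ∧ Admissible gpu ∧ Admissible gpp)
    (u₁ u₂ u₁t u₁x u₁xx u₂t u₂x u₂xx : ℝ → ℝ → ℝ)
    (hu₁_cont : ContinuousOn (fun p : ℝ × ℝ => u₁ p.1 p.2) (Set.Ici 0 ×ˢ Set.univ))
    (hu₂_cont : ContinuousOn (fun p : ℝ × ℝ => u₂ p.1 p.2) (Set.Ici 0 ×ˢ Set.univ))
    (hu₁t_cont : ContinuousOn (fun p : ℝ × ℝ => u₁t p.1 p.2) (Set.Ioi 0 ×ˢ Set.univ))
    (hu₁x_cont : ContinuousOn (fun p : ℝ × ℝ => u₁x p.1 p.2) (Set.Ioi 0 ×ˢ Set.univ))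
    (hu₁xx_cont : ContinuousOn (fun p : ℝ × ℝ => u₁xx p.1 p.2) (Set.Ioi 0 ×ˢ Set.univ))
    (hu₂t_cont : ContinuousOn (fun p : ℝ × ℝ => u₂t p.1 p.2) (Set.Ioi 0 ×ˢ Set.univ))
    (hu₂x_cont : ContinuousOn (fun p : ℝ × ℝ => u₂x p.1 p.2) (Set.Ioi 0 ×ˢ Set.univ))
    (hu₂xx_cont : ContinuousOn (fun p : ℝ × ℝ => u₂xx p.1 p.2) (Set.Ioi 0 ×ˢ Set.univ))
    (hu₁per : ∀ t ≥ (0:ℝ), ∀ x : ℝ, u₁ t (x + 2 * Real.pi) = u₁ t x)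
    (hu₂per : ∀ t ≥ (0:ℝ), ∀ x : ℝ, u₂ t (x + 2 * Real.pi) = u₂ t x)
    (hu₁_dt : ∀ t > (0:ℝ), ∀ x : ℝ, HasDerivAt (fun s => u₁ s x) (u₁t t x) t)
    (hu₁_dx : ∀ t > (0:ℝ), ∀ x : ℝ, HasDerivAt (fun y => u₁ t y) (u₁x t x) x)
    (hu₁_dxx : ∀ t > (0:ℝ), ∀ x : ℝ, HasDerivAt (fun y => u₁x t y) (u₁xx t x) x)
    (hu₂_dt : ∀ t > (0:ℝ), ∀ x : ℝ, HasDerivAt (fun s => u₂ s x) (u₂t t x) t)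
    (hu₂_dx : ∀ t > (0:ℝ), ∀ x : ℝ, HasDerivAt (fun y => u₂ t y) (u₂x t x) x)
    (hu₂_dxx : ∀ t > (0:ℝ), ∀ x : ℝ, HasDerivAt (fun y => u₂x t y) (u₂xx t x) x)
    (heq₁ : ∀ t > (0:ℝ), ∀ x : ℝ, u₁t t x = u₁xx t x + g t (u₁ t x) (u₁x t x))
    (heq₂ : ∀ t > (0:ℝ), ∀ x : ℝ, u₂t t x = u₂xx t x + g t (u₂ t x) (u₂x t x))
    (hbdd : ∀ η > (0:ℝ), ∃ M : ℝ, ∀ t ≥ η, ∀ x : ℝ,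
      |u₁ t x| ≤ M ∧ |u₁x t x| ≤ M ∧ |u₂ t x| ≤ M ∧ |u₂x t x| ≤ M)
    (hdist : ∀ t ≥ (0:ℝ), ∃ x : ℝ, u₁ t x ≠ u₂ t x) :
    (∀ t > (0:ℝ), zeroNum (fun x => u₁ t x - u₂ t x) < ⊤) ∧
    (∀ t₁ t₂ : ℝ, 0 < t₁ → t₁ ≤ t₂ →
      zeroNum (fun x => u₁ t₂ x - u₂ t₂ x) ≤ zeroNum (fun x => u₁ t₁ x - u₂ t₁ x)) := by
  have S : Sol (fun t x => u₁ t x - u₂ t x) (fun t x => u₁t t x - u₂t t x)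
      (fun t x => u₁x t x - u₂x t x) (fun t x => u₁xx t x - u₂xx t x) := by
    have sub : (Set.Ioi (0:ℝ) ×ˢ (Set.univ : Set ℝ)) ⊆ Set.Ici 0 ×ˢ Set.univ :=
      Set.prod_mono Ioi_subset_Ici_self le_rfl
    refine ⟨(hu₁_cont.mono sub).sub (hu₂_cont.mono sub), hu₁t_cont.sub hu₂t_cont, hu₁x_cont.sub hu₂x_cont,
      hu₁xx_cont.sub hu₂xx_cont, ?_, ?_, ?_, ?_, ?_, ?_⟩
    · intro t ht x
      simp only [hu₁per t ht.le, hu₂per t ht.le]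
    · exact fun t ht x => (hu₁_dt t ht x).fun_sub (hu₂_dt t ht x)
    · exact fun t ht x => (hu₁_dx t ht x).fun_sub (hu₂_dx t ht x)
    · exact fun t ht x => (hu₁_dxx t ht x).fun_sub (hu₂_dxx t ht x)
    · intro η hη
      obtain ⟨M, hM⟩ := hbdd η hη
      obtain ⟨_, hau, hap, _⟩ := hadm
      have hK : IsCompact (Icc (-M) M ×ˢ Icc (-M) M) := isCompact_Icc.prod isCompact_Icc
      obtain ⟨A, hA⟩ := (hau _ hK).1
      obtain ⟨B, hB⟩ := (hap _ hK).1
      refine ⟨max A B, fun t ht x => ?_⟩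
      have tp : 0 < t := lt_of_lt_of_le hη ht
      obtain ⟨m1, m2, m3, m4⟩ := hM t ht x
      have e1 : |g t (u₁ t x) (u₁x t x) - g t (u₂ t x) (u₁x t x)| ≤ A * |u₁ t x - u₂ t x| :=
        lip_aux (f := fun w => g t w (u₁x t x)) (fun w => hgu t w (u₁x t x))
          (fun w hw => hA t (w, u₁x t x) ⟨hw, abs_le.1 m2⟩) m1 m3
      have e2 : |g t (u₂ t x) (u₁x t x) - g t (u₂ t x) (u₂x t x)| ≤ B * |u₁x t x - u₂x t x| :=
        lip_aux (f := fun w => g t (u₂ t x) w) (fun w => hgp t (u₂ t x) w)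
          (fun w hw => hB t (u₂ t x, w) ⟨abs_le.1 m3, hw⟩) m2 m4
      have e3 : u₁t t x - u₂t t x - (u₁xx t x - u₂xx t x) =
          (g t (u₁ t x) (u₁x t x) - g t (u₂ t x) (u₁x t x)) +
          (g t (u₂ t x) (u₁x t x) - g t (u₂ t x) (u₂x t x)) := by
        rw [heq₁ t tp x, heq₂ t tp x]; ring
      have e4 : A * |u₁ t x - u₂ t x| ≤ max A B * |u₁ t x - u₂ t x| :=
        mul_le_mul_of_nonneg_right (le_max_left _ _) (abs_nonneg _)
      have e5 : B * |u₁x t x - u₂x t x| ≤ max A B * |u₁x t x - u₂x t x| :=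
        mul_le_mul_of_nonneg_right (le_max_right _ _) (abs_nonneg _)
      rw [e3, mul_add]
      exact (abs_add_le _ _).trans (by linarith)
    · intro t ht
      obtain ⟨x, hx⟩ := hdist t ht.le
      exact ⟨x, sub_ne_zero.2 hx⟩
  refine ⟨fun t ht => ?_, fun t₁ t₂ h1 h12 => ?_⟩
  · exact Set.encard_lt_top_iff.2 (S.finite ht)
  · exact S.mono h1 h12
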